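/- arXiv:1805.05025 — 2 statements merged into one kernel-verified Lean document; each statement's English description precedes it below -/
import Mathlib

section
/- Let β > 0 be given, and let T := ⌈(1/2)·n·log n⌉ + ⌈β·n⌉. Then there is a constant C_G depending only on G such that for any σ_* ∈ S_*(1/(5Q³)) and all sufficiently large n, the total-variation distance between the law of σ_T under the product replacement chain started at σ_* and the uniform stationary distribution π is at most C_G/β^{1/4}. -/
open scoped BigOperators
open Filter

attribute [local instance] Classical.propDecidable

noncomputable section

namespace PR

variable (G : Type) [Group G] [Fintype G]

/-- A configuration: an `n`-tuple of elements of `G`. -/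
abbrev Config (n : ℕ) := Fin n → G

/-- The set of generating `n`-tuples. -/
def gens (n : ℕ) : Set (Config G n) :=
  {σ | Subgroup.closure (Set.range σ) = ⊤}

/-- A move of the product replacement chain: an ordered pair of distinct indices
together with a sign (`true` = multiply, `false` = multiply by inverse). -/
abbrev Move (n : ℕ) := {p : Fin n × Fin n // p.1 ≠ p.2} × Bool

/-- Applying a move: replace `σ i` by `σ i * (σ j)^{±1}`. -/
def applyMove {n : ℕ} (σ : Config G n) (m : Move n) : Config G n :=
  Function.update σ m.1.1.1
    (σ m.1.1.1 * (if m.2 then σ m.1.1.2 else (σ m.1.1.2)⁻¹))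

/-- One-step transition probability of the product replacement chain. -/
def step {n : ℕ} (σ σ' : Config G n) : ℝ :=
  ((Finset.univ.filter (fun m : Move n => applyMove G σ m = σ')).card : ℝ) /
    (Fintype.card (Move n) : ℝ)

/-- The law of `σ_t` for the chain started at `σ₀`. -/
def law {n : ℕ} (σ₀ : Config G n) : ℕ → Config G n → ℝ
  | 0 => fun σ' => if σ' = σ₀ then 1 else 0
  | (t + 1) => fun σ' => ∑ τ : Config G n, law σ₀ t τ * step G τ σ'

/-- Probability that `σ_t ∈ E` for the chain started at `σ₀`. -/
def prob {n : ℕ} (σ₀ : Config G n) (t : ℕ) (E : Set (Config G n)) : ℝ :=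
  ∑ τ ∈ Finset.univ.filter (fun τ => τ ∈ E), law G σ₀ t τ

/-- Probability of a trajectory event for the chain started at `σ₀`, over the
time horizon `{0, 1, …, T}`. -/
def pathProb {n : ℕ} (σ₀ : Config G n) (T : ℕ)
    (E : Set (Fin (T + 1) → Config G n)) : ℝ :=
  ∑ p ∈ Finset.univ.filter
      (fun p : Fin (T + 1) → Config G n => p 0 = σ₀ ∧ p ∈ E),
    ∏ t : Fin T, step G (p t.castSucc) (p t.succ)

/-- `n_a(σ)`: the number of sites holding the group element `a`. -/
def nCount {n : ℕ} (σ : Config G n) (a : G) : ℕ :=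
  (Finset.univ.filter (fun i => σ i = a)).card

/-- `n^H_non(σ)`: the number of sites whose element lies outside `H`. -/
def nNon {n : ℕ} (H : Subgroup G) (σ : Config G n) : ℕ :=
  (Finset.univ.filter (fun i => σ i ∉ H)).card

/-- `n^{id}_non(σ)`: the number of sites not holding the identity. -/
def nNonId {n : ℕ} (σ : Config G n) : ℕ :=
  (Finset.univ.filter (fun i => σ i ≠ 1)).card

/-- `S_non(c)`. -/
def SNon (n : ℕ) (c : ℝ) : Set (Config G n) :=
  {σ | σ ∈ gens G n ∧
    ∀ H : Subgroup G, H ≠ ⊤ → c * n ≤ (nNon G H σ : ℝ)}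

/-- The `δ`-typical set `S_*(δ)`. -/
def SAst (n : ℕ) (δ : ℝ) : Set (Config G n) :=
  {σ | σ ∈ gens G n ∧
    Real.sqrt (∑ a : G, ((nCount G σ a : ℝ) / n - 1 / (Fintype.card G : ℝ)) ^ 2) ≤ δ}

/-- `n^{σ₀}_{a,b}(σ)`. -/
def nab {n : ℕ} (σ₀ σ : Config G n) (a b : G) : ℕ :=
  (Finset.univ.filter (fun i => σ₀ i = a ∧ σ i = b)).card

/-- `S_*(σ₀, r)`. -/
def SAstM {n : ℕ} (σ₀ : Config G n) (r : ℝ) : Set (Config G n) :=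
  {σ | σ ∈ gens G n ∧
    ∀ a : G, Real.sqrt (∑ b : G,
      ((nab G σ₀ σ a b : ℝ) / (nCount G σ₀ a : ℝ) - 1 / (Fintype.card G : ℝ)) ^ 2) ≤ r}

/-- The uniform stationary distribution `π` on the set of generating tuples. -/
def statDist (n : ℕ) : Config G n → ℝ := fun σ =>
  if σ ∈ gens G n then
    1 / ((Finset.univ.filter (fun τ : Config G n => τ ∈ gens G n)).card : ℝ)
  else 0

/-- Total-variation distance between two (finitely supported) signed weights,
as the supremum over finite sets `A` of `|p(A) - q(A)|`. -/
def tvDist {α : Type*} (p q : α → ℝ) : ℝ :=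
  sSup {x : ℝ | ∃ A : Finset α, x = |∑ a ∈ A, p a - ∑ a ∈ A, q a|}

/-- `d_σ(t) = max_{A ⊆ S} |P_σ(σ_t ∈ A) - π(A)|`. -/
def dTV {n : ℕ} (σ : Config G n) (t : ℕ) : ℝ :=
  sSup {x : ℝ | ∃ A : Finset (Config G n), ↑A ⊆ gens G n ∧
    x = |∑ τ ∈ A, law G σ t τ - ∑ τ ∈ A, statDist G n τ|}

/-- `max_{σ ∈ S} d_σ(t)`. -/
def dMax (n : ℕ) (t : ℕ) : ℝ :=
  sSup {x : ℝ | ∃ σ ∈ gens G n, x = dTV G σ t}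

end PR

namespace PR

section Operator

set_option linter.unusedSectionVars false

variable {G : Type} [Group G] [Fintype G] {n : ℕ}

/-- The group element `g` or its inverse, according to a sign. -/
def signed (ε : Bool) (g : G) : G := if ε then g else g⁻¹

/-- The transition operator of the product replacement chain, acting on functions. -/
def stepOp (f : Config G n → ℝ) : Config G n → ℝ := fun x =>
  (∑ m : Move n, f (applyMove G x m)) / (Fintype.card (Move n) : ℝ)

lemma sum_move (F : Fin n → Fin n → Bool → ℝ) :
    ∑ m : Move n, F m.1.1.1 m.1.1.2 m.2 =
      ∑ i, ∑ j, ∑ ε, if j ≠ i then F i j ε else 0 := by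
  rw [Fintype.sum_prod_type]
  have h : ∑ p ∈ Finset.univ.filter (fun p : Fin n × Fin n => p.1 ≠ p.2), ∑ ε, F p.1 p.2 ε =
      ∑ p : {p : Fin n × Fin n // p.1 ≠ p.2}, ∑ ε, F p.1.1 p.1.2 ε :=
    Finset.sum_subtype _ (by simp) _
  rw [← h, Finset.sum_filter, Fintype.sum_prod_type]
  refine Finset.sum_congr rfl fun i _ => Finset.sum_congr rfl fun j _ => ?_
  by_cases hij : i = j
  · simp [hij]
  · simp [hij, Ne.symm hij]

lemma sum_ne_const (i : Fin n) (a : ℝ) :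
    ∑ j, ∑ _ε : Bool, (if j ≠ i then a else 0) = 2 * ((n : ℝ) - 1) * a := by
  have : ∀ j : Fin n, ∑ _ε : Bool, (if j ≠ i then a else 0) = 2 * a - if j = i then 2 * a else 0 := by
    intro j
    by_cases h : j = i <;> simp [h, two_mul]
  simp only [this, Finset.sum_sub_distrib, Finset.sum_ite_eq', Finset.mem_univ, if_true]
  simp
  ring

lemma card_move : (Fintype.card (Move n) : ℝ) = n * (2 * ((n : ℝ) - 1)) := by
  have h := sum_move (n := n) (fun _ _ _ => 1)
  simp only [sum_ne_const] at h
  simpa using h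

lemma stepOp_apply (f : Config G n → ℝ) (x : Config G n) :
    stepOp f x = (∑ i, ∑ j, ∑ ε, if j ≠ i then
      f (Function.update x i (x i * signed ε (x j))) else 0) / (n * (2 * ((n : ℝ) - 1))) := by
  unfold stepOp
  rw [card_move, ← sum_move (fun i j ε => f (Function.update x i (x i * signed ε (x j))))]
  rfl

lemma stepOp_mono {f g : Config G n → ℝ} (h : ∀ x, f x ≤ g x) (x : Config G n) :
    stepOp f x ≤ stepOp g x := by
  unfold stepOp
  gcongr
  exact h _

lemma stepOp_add (f g : Config G n → ℝ) (x : Config G n) :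
    stepOp (fun y => f y + g y) x = stepOp f x + stepOp g x := by
  unfold stepOp
  rw [Finset.sum_add_distrib, add_div]

lemma stepOp_mul_left (a : ℝ) (f : Config G n → ℝ) (x : Config G n) :
    stepOp (fun y => a * f y) x = a * stepOp f x := by
  unfold stepOp
  rw [← Finset.mul_sum, mul_div_assoc]

lemma card_move_ne_zero (hn : 2 ≤ n) : (Fintype.card (Move n) : ℝ) ≠ 0 := by
  have : (2 : ℝ) ≤ n := by exact_mod_cast hn
  rw [card_move]
  have : (0 : ℝ) < n * (2 * ((n : ℝ) - 1)) := by
    apply mul_pos <;> linarith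
  exact this.ne'

lemma stepOp_const (hn : 2 ≤ n) (a : ℝ) (x : Config G n) :
    stepOp (fun _ => a) x = a := by
  have := card_move_ne_zero hn
  unfold stepOp
  rw [Finset.sum_const, Finset.card_univ, nsmul_eq_mul]
  field_simp

lemma stepOp_le_one (hn : 2 ≤ n) {f : Config G n → ℝ} (h : ∀ x, f x ≤ 1) (x : Config G n) :
    stepOp f x ≤ 1 :=
  (stepOp_mono h x).trans_eq (stepOp_const hn 1 x)

lemma stepOp_nonneg {f : Config G n → ℝ} (h : ∀ x, 0 ≤ f x) (x : Config G n) :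
    0 ≤ stepOp f x := by
  unfold stepOp
  exact div_nonneg (Finset.sum_nonneg fun _ _ => h _) (Nat.cast_nonneg _)

lemma iterate_stepOp_nonneg {f : Config G n → ℝ} (h : ∀ x, 0 ≤ f x) (t : ℕ) :
    ∀ x, 0 ≤ (stepOp^[t] f) x := by
  induction t with
  | zero => exact h
  | succ t ih =>
    rw [Function.iterate_succ_apply']
    exact stepOp_nonneg ih

lemma iterate_stepOp_le_one (hn : 2 ≤ n) {f : Config G n → ℝ} (h : ∀ x, f x ≤ 1) (t : ℕ) :
    ∀ x, (stepOp^[t] f) x ≤ 1 := by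
  induction t with
  | zero => exact h
  | succ t ih =>
    rw [Function.iterate_succ_apply']
    exact stepOp_le_one hn ih

lemma sum_step_mul (f : Config G n → ℝ) (x : Config G n) :
    ∑ y, step G x y * f y = stepOp f x := by
  unfold step stepOp
  rw [← Finset.sum_fiberwise Finset.univ (fun m : Move n => applyMove G x m), Finset.sum_div]
  refine Finset.sum_congr rfl fun y _ => ?_
  rw [Finset.sum_congr rfl (g := fun _ => f y)]
  · rw [Finset.sum_const, nsmul_eq_mul]
    ring
  · intro m hm
    rw [(Finset.mem_filter.1 hm).2]

lemma sum_law_mul (σ : Config G n) (t : ℕ) (f : Config G n → ℝ) :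
    ∑ y, law G σ t y * f y = (stepOp^[t] f) σ := by
  induction t generalizing f with
  | zero => simp [law]
  | succ t ih =>
    rw [Function.iterate_succ_apply, ← ih]
    simp only [law, Finset.sum_mul]
    rw [Finset.sum_comm]
    refine Finset.sum_congr rfl fun τ _ => ?_
    rw [← sum_step_mul, Finset.mul_sum]
    exact Finset.sum_congr rfl fun y _ => mul_assoc _ _ _

lemma update_mul_bijective (i : Fin n) (u : Config G n → G)
    (hu : ∀ x v, u (Function.update x i v) = u x) :
    Function.Bijective fun x : Config G n => Function.update x i (x i * u x) := by
  refine Finite.injective_iff_bijective.1 fun x y h => ?_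
  have hne : ∀ l, l ≠ i → x l = y l := by
    intro l hl
    have := congrFun h l
    simpa [hl] using this
  have hxy : x = Function.update y i (x i) := by
    ext l
    by_cases hl : l = i
    · subst hl
      simp
    · simp [hl, hne l hl]
  have hu' : u x = u y := by
    rw [hxy, hu]
  have hi : x i = y i := by
    have := congrFun h i
    simpa [hu'] using this
  ext l
  by_cases hl : l = i
  · rw [hl, hi]
  · exact hne l hl

lemma sum_update_mul (i : Fin n) (u : Config G n → G)
    (hu : ∀ x v, u (Function.update x i v) = u x) (f : Config G n → ℝ) :
    ∑ x : Config G n, f (Function.update x i (x i * u x)) = ∑ x, f x :=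
  (update_mul_bijective i u hu).sum_comp f

lemma sum_stepOp (hn : 2 ≤ n) (f : Config G n → ℝ) :
    ∑ x, stepOp f x = ∑ x, f x := by
  have h0 := card_move_ne_zero hn
  unfold stepOp
  rw [← Finset.sum_div, Finset.sum_comm, div_eq_iff h0]
  have : ∀ m : Move n, ∑ x, f (applyMove G x m) = ∑ x, f x := by
    intro m
    refine sum_update_mul m.1.1.1
      (fun x => if m.2 then x m.1.1.2 else (x m.1.1.2)⁻¹) (fun x v => ?_) f
    have : m.1.1.2 ≠ m.1.1.1 := Ne.symm m.1.2
    simp [this]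
  rw [Finset.sum_congr rfl fun m _ => this m, Finset.sum_const, Finset.card_univ, nsmul_eq_mul,
    mul_comm]

lemma sum_iterate_stepOp (hn : 2 ≤ n) (f : Config G n → ℝ) (t : ℕ) :
    ∑ x, (stepOp^[t] f) x = ∑ x, f x := by
  induction t with
  | zero => rfl
  | succ t ih => rw [Function.iterate_succ_apply', sum_stepOp hn, ih]

lemma stepOp_comp_perm (ρ : Equiv.Perm (Fin n)) (f : Config G n → ℝ) (x : Config G n) :
    stepOp f (x ∘ ρ) = stepOp (fun y => f (y ∘ ρ)) x := by
  have key : ∀ (i : Fin n) (v : G),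
      Function.update (x ∘ ρ) i v = Function.update x (ρ i) v ∘ ρ := by
    intro i v
    ext l
    by_cases hl : l = i
    · simp [hl]
    · simp [hl]
  rw [stepOp_apply, stepOp_apply]
  congr 1
  refine Eq.trans (Finset.sum_congr rfl fun i _ => ?_) (Equiv.sum_comp ρ _)
  refine Eq.trans ?_ (Equiv.sum_comp ρ _)
  refine Finset.sum_congr rfl fun j _ => Finset.sum_congr rfl fun ε _ => ?_
  simp [key]

lemma iterate_stepOp_comp_perm (ρ : Equiv.Perm (Fin n)) (t : ℕ) (f : Config G n → ℝ)
    (x : Config G n) :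
    (stepOp^[t] f) (x ∘ ρ) = (stepOp^[t] (fun y => f (y ∘ ρ))) x := by
  induction t generalizing f x with
  | zero => rfl
  | succ t ih =>
    rw [Function.iterate_succ_apply, Function.iterate_succ_apply, ih]
    exact congrArg (fun g => (stepOp^[t] g) x) (funext fun y => stepOp_comp_perm ρ f y)

end Operator

end PR

namespace PR

section Deviation

set_option linter.unusedSectionVars false

variable {G : Type} [Group G] [Fintype G] {n : ℕ} {K : Type} [Fintype K]

/-- The number of sites with label `k` holding `b`, minus its mean under uniform sampling. -/
def dev (c : Fin n → K) (x : Config G n) (k : K) (b : G) : ℝ :=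
  ∑ i, if c i = k then ((if x i = b then 1 else 0) - 1 / (Fintype.card G : ℝ)) else 0

/-- The sum of the squared deviations of the joint counts. -/
def sqDev (c : Fin n → K) (x : Config G n) : ℝ := ∑ k, ∑ b, dev c x k b ^ 2

lemma sqDev_nonneg (c : Fin n → K) (x : Config G n) : 0 ≤ sqDev c x :=
  Finset.sum_nonneg fun _ _ => Finset.sum_nonneg fun _ _ => sq_nonneg _

lemma card_ne_zero' : (Fintype.card G : ℝ) ≠ 0 := by
  exact_mod_cast Fintype.card_ne_zero

lemma one_le_card : (1 : ℝ) ≤ (Fintype.card G : ℝ) := by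
  exact_mod_cast Fintype.card_pos

lemma sum_dev (c : Fin n → K) (x : Config G n) (k : K) : ∑ b, dev c x k b = 0 := by
  unfold dev
  rw [Finset.sum_comm]
  refine Finset.sum_eq_zero fun i _ => ?_
  split_ifs
  · have := card_ne_zero' (G := G)
    simp [Finset.sum_sub_distrib, this]
  · simp

lemma sum_eq_sum_dev_mul (c : Fin n → K) (x : Config G n) (F : K → G → ℝ)
    (hF : ∀ k, ∑ b, F k b = 0) :
    ∑ i, F (c i) (x i) = ∑ k, ∑ b, dev c x k b * F k b := by
  have h : ∀ i, F (c i) (x i) = ∑ k, ∑ b,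
      (if c i = k then ((if x i = b then 1 else 0) - 1 / (Fintype.card G : ℝ)) else 0) * F k b := by
    intro i
    rw [Finset.sum_eq_single (c i)]
    · simp only [if_true, sub_mul, Finset.sum_sub_distrib, ← Finset.mul_sum, hF]
      simp
    · intro k _ hk
      simp [Ne.symm hk]
    · simp
  rw [Finset.sum_congr rfl fun i _ => h i, Finset.sum_comm]
  refine Finset.sum_congr rfl fun k _ => ?_
  rw [Finset.sum_comm]
  refine Finset.sum_congr rfl fun b _ => ?_
  rw [dev, Finset.sum_mul]

lemma sum_dev_self (c : Fin n → K) (x : Config G n) :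
    ∑ i, dev c x (c i) (x i) = sqDev c x := by
  rw [sum_eq_sum_dev_mul c x (dev c x) (sum_dev c x)]
  simp only [sqDev, sq]

lemma dev_update (c : Fin n → K) (x : Config G n) (i : Fin n) (v : G) (k : K) (b : G) :
    dev c (Function.update x i v) k b = dev c x k b +
      if c i = k then ((if v = b then 1 else 0) - (if x i = b then 1 else 0)) else 0 := by
  have h : ∀ l, (if c l = k then ((if Function.update x i v l = b then 1 else 0)
        - 1 / (Fintype.card G : ℝ)) else 0) =
      (if c l = k then ((if x l = b then 1 else 0) - 1 / (Fintype.card G : ℝ)) else 0) +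
      if l = i then (if c i = k then ((if v = b then 1 else 0) - (if x i = b then 1 else 0))
        else 0) else 0 := by
    intro l
    by_cases hl : l = i
    · subst hl
      by_cases hk : c l = k
      · simp only [Function.update_self, hk, if_true]
        ring
      · simp [hk]
    · simp [hl]
  unfold dev
  rw [Finset.sum_congr rfl fun l _ => h l, Finset.sum_add_distrib]
  simp

lemma abs_dev_le (c : Fin n → K) (x : Config G n) (k : K) (b : G) : |dev c x k b| ≤ n := by
  unfold dev
  refine (Finset.abs_sum_le_sum_abs _ _).trans ?_
  have h : ∀ i ∈ (Finset.univ : Finset (Fin n)),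
      |if c i = k then ((if x i = b then 1 else 0) - 1 / (Fintype.card G : ℝ)) else 0| ≤ 1 := by
    intro i _
    have h1 := one_le_card (G := G)
    have h2 : 1 / (Fintype.card G : ℝ) ≤ 1 := by
      rw [div_le_one (by linarith)]
      exact h1
    have h3 : 0 ≤ 1 / (Fintype.card G : ℝ) := by positivity
    split_ifs <;> rw [abs_le] <;> constructor <;> linarith
  refine (Finset.sum_le_sum h).trans ?_
  simp

lemma sqDev_update_eq (c : Fin n → K) (x : Config G n) (i : Fin n) (v : G) :
    sqDev c (Function.update x i v) = sqDev c x + 2 * (dev c x (c i) v - dev c x (c i) (x i)) +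
      ∑ b, ((if v = b then (1 : ℝ) else 0) - (if x i = b then 1 else 0)) ^ 2 := by
  have h1 : ∀ k b, dev c (Function.update x i v) k b ^ 2 = dev c x k b ^ 2 +
      if c i = k then (2 * (dev c x k b * ((if v = b then 1 else 0) - (if x i = b then 1 else 0)))
        + ((if v = b then (1 : ℝ) else 0) - (if x i = b then 1 else 0)) ^ 2) else 0 := by
    intro k b
    rw [dev_update]
    split_ifs <;> ring
  unfold sqDev
  simp only [h1, Finset.sum_add_distrib]
  rw [add_assoc]
  congr 1
  rw [Finset.sum_eq_single (c i)]
  · simp only [if_true, Finset.sum_add_distrib, ← Finset.mul_sum, mul_sub, Finset.sum_sub_distrib]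
    simp
  · intro k _ hk
    simp [Ne.symm hk]
  · simp

lemma sqDev_update_le (c : Fin n → K) (x : Config G n) (i : Fin n) (v : G) :
    sqDev c (Function.update x i v) ≤
      sqDev c x + 2 * (dev c x (c i) v - dev c x (c i) (x i)) + 2 := by
  rw [sqDev_update_eq]
  gcongr
  calc ∑ b, ((if v = b then (1 : ℝ) else 0) - (if x i = b then 1 else 0)) ^ 2
      ≤ ∑ b, ((if v = b then (1 : ℝ) else 0) + (if x i = b then 1 else 0)) := by
        refine Finset.sum_le_sum fun b _ => ?_
        split_ifs <;> norm_num
    _ = 2 := by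
        rw [Finset.sum_add_distrib]
        simp
        norm_num

lemma abs_sqDev_update_sub_le (c : Fin n → K) (x : Config G n) (i : Fin n) (v : G) :
    |sqDev c (Function.update x i v) - sqDev c x| ≤ 4 * n + 2 := by
  have h1 := sqDev_update_le c x i v
  have h2 := sqDev_update_eq c x i v
  have h3 : 0 ≤ ∑ b, ((if v = b then (1 : ℝ) else 0) - (if x i = b then 1 else 0)) ^ 2 :=
    Finset.sum_nonneg fun _ _ => sq_nonneg _
  have h4 := abs_le.1 (abs_dev_le c x (c i) v)
  have h5 := abs_le.1 (abs_dev_le c x (c i) (x i))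
  rw [abs_le]
  constructor <;> linarith

/-- The total deviation of the unlabelled counts. -/
def absDev (x : Config G n) : ℝ := ∑ g, |dev (fun _ => ()) x () g|

lemma sum_mul_right (u : G) (F : G → ℝ) : ∑ b, F (b * u) = ∑ b, F b :=
  Equiv.sum_comp (Equiv.mulRight u) F

lemma sum_mul_left (u : G) (F : G → ℝ) : ∑ b, F (u * b) = ∑ b, F b :=
  Equiv.sum_comp (Equiv.mulLeft u) F

lemma signed_bijective (ε : Bool) (b : G) : Function.Bijective fun g => b * signed ε g := by
  cases ε
  · exact (MulAction.bijective b).comp (Equiv.inv G).bijective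
  · exact MulAction.bijective b

lemma abs_sum_dev_mul_dev_le (c : Fin n → K) (x : Config G n) (u : G) :
    |∑ k, ∑ b, dev c x k b * dev c x k (b * u)| ≤ sqDev c x := by
  refine (Finset.abs_sum_le_sum_abs _ _).trans (Finset.sum_le_sum fun k _ => ?_)
  refine (Finset.abs_sum_le_sum_abs _ _).trans ?_
  calc ∑ b, |dev c x k b * dev c x k (b * u)|
      ≤ ∑ b, (dev c x k b ^ 2 / 2 + dev c x k (b * u) ^ 2 / 2) := by
        refine Finset.sum_le_sum fun b _ => ?_
        rw [abs_mul, ← sq_abs (dev c x k b), ← sq_abs (dev c x k (b * u))]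
        nlinarith [sq_nonneg (|dev c x k b| - |dev c x k (b * u)|)]
    _ = ∑ b, dev c x k b ^ 2 := by
        rw [Finset.sum_add_distrib,
          sum_mul_right u (fun b => dev c x k b ^ 2 / 2),
          ← Finset.sum_add_distrib]
        exact Finset.sum_congr rfl fun b _ => by ring

lemma abs_sum_sum_dev_le (c : Fin n → K) (x : Config G n) (ε : Bool) :
    |∑ i, ∑ j, dev c x (c i) (x i * signed ε (x j))| ≤ absDev x * sqDev c x := by
  have h1 : ∀ i, ∑ j, dev c x (c i) (x i * signed ε (x j)) =
      ∑ g, dev (fun _ => ()) x () g * dev c x (c i) (x i * signed ε g) := by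
    intro i
    have := sum_eq_sum_dev_mul (fun _ => ()) x (fun _ g => dev c x (c i) (x i * signed ε g))
      (fun _ => by
        rw [(signed_bijective ε (x i)).sum_comp (fun g => dev c x (c i) g), sum_dev])
    simpa using this
  have h2 : ∀ g, ∑ i, dev c x (c i) (x i * signed ε g) =
      ∑ k, ∑ b, dev c x k b * dev c x k (b * signed ε g) := by
    intro g
    refine sum_eq_sum_dev_mul c x (fun k b => dev c x k (b * signed ε g)) fun k => ?_
    rw [sum_mul_right (signed ε g) (fun b => dev c x k b), sum_dev]
  rw [Finset.sum_congr rfl fun i _ => h1 i, Finset.sum_comm]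
  simp only [← Finset.mul_sum, h2]
  refine (Finset.abs_sum_le_sum_abs _ _).trans ?_
  rw [absDev, Finset.sum_mul]
  refine Finset.sum_le_sum fun g _ => ?_
  rw [abs_mul]
  exact mul_le_mul_of_nonneg_left (abs_sum_dev_mul_dev_le c x _) (abs_nonneg _)

lemma stepOp_sqDev_le (hn : 2 ≤ n) (c : Fin n → K) (x : Config G n) :
    stepOp (sqDev c) x ≤
      sqDev c x * (1 - 2 / n + 2 * (absDev x / n) / ((n : ℝ) - 1)) + 6 := by
  have hn' : (2 : ℝ) ≤ n := by exact_mod_cast hn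
  have hn1 : (0 : ℝ) < (n : ℝ) - 1 := by linarith
  have hn0 : (0 : ℝ) < n := by linarith
  rw [stepOp_apply, div_le_iff₀ (by positivity)]
  have hall : ∑ i, ∑ j, ∑ ε, dev c x (c i) (x i * signed ε (x j)) ≤
      2 * (absDev x * sqDev c x) := by
    have : ∑ i, ∑ j, ∑ ε, dev c x (c i) (x i * signed ε (x j)) =
        ∑ ε, ∑ i, ∑ j, dev c x (c i) (x i * signed ε (x j)) := by
      rw [Finset.sum_comm]
      rw [Finset.sum_congr rfl fun i _ => Finset.sum_comm]
      rw [Finset.sum_comm]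
      refine Finset.sum_congr rfl fun ε _ => Finset.sum_comm
    rw [this]
    calc _ ≤ ∑ _ε : Bool, absDev x * sqDev c x :=
          Finset.sum_le_sum fun ε _ => (le_abs_self _).trans (abs_sum_sum_dev_le c x ε)
      _ = _ := by simp
  have hdiag : -(2 * (n : ℝ) * n) ≤ ∑ i, ∑ ε, dev c x (c i) (x i * signed ε (x i)) := by
    calc -(2 * (n : ℝ) * n) = ∑ _i : Fin n, ∑ _ε : Bool, -(n : ℝ) := by
          simp
          ring
      _ ≤ _ := Finset.sum_le_sum fun i _ => Finset.sum_le_sum fun ε _ =>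
          (abs_le.1 (abs_dev_le c x _ _)).1
  have hsplit : ∑ i, ∑ j, ∑ ε, (if j ≠ i then dev c x (c i) (x i * signed ε (x j)) else 0) =
      ∑ i, ∑ j, ∑ ε, dev c x (c i) (x i * signed ε (x j)) -
        ∑ i, ∑ ε, dev c x (c i) (x i * signed ε (x i)) := by
    rw [← Finset.sum_sub_distrib]
    refine Finset.sum_congr rfl fun i _ => ?_
    have : ∀ j, ∑ ε, (if j ≠ i then dev c x (c i) (x i * signed ε (x j)) else 0) =
        ∑ ε, dev c x (c i) (x i * signed ε (x j)) -
          if j = i then ∑ ε, dev c x (c i) (x i * signed ε (x i)) else 0 := by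
      intro j
      by_cases h : j = i
      · subst h
        simp
      · simp [h]
    rw [Finset.sum_congr rfl fun j _ => this j, Finset.sum_sub_distrib]
    simp
  have hbound : ∑ i, ∑ j, ∑ ε, (if j ≠ i then
        sqDev c (Function.update x i (x i * signed ε (x j))) else 0) ≤
      ∑ i, ∑ j, ∑ ε, ((if j ≠ i then (sqDev c x + 2 - 2 * dev c x (c i) (x i)) else 0) +
        2 * if j ≠ i then dev c x (c i) (x i * signed ε (x j)) else 0) := by
    refine Finset.sum_le_sum fun i _ => Finset.sum_le_sum fun j _ =>
      Finset.sum_le_sum fun ε _ => ?_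
    split_ifs
    · have := sqDev_update_le c x i (x i * signed ε (x j))
      linarith
    · simp
  refine hbound.trans ?_
  simp only [Finset.sum_add_distrib, ← Finset.mul_sum, hsplit, sum_ne_const]
  rw [Finset.sum_sub_distrib, ← Finset.mul_sum, sum_dev_self]
  simp only [Finset.sum_const, Finset.card_univ, Fintype.card_fin, nsmul_eq_mul]
  have : (sqDev c x * (1 - 2 / n + 2 * (absDev x / n) / ((n : ℝ) - 1)) + 6) *
      (n * (2 * ((n : ℝ) - 1))) =
      sqDev c x * (n * (2 * ((n : ℝ) - 1)) - 4 * ((n : ℝ) - 1) + 4 * absDev x)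
        + 6 * (n * (2 * ((n : ℝ) - 1))) := by
    field_simp
    ring
  rw [this]
  nlinarith

/-- Under uniform sampling, the expected squared deviation is at most `n`. -/
lemma sum_sqDev_le (hn : 1 ≤ n) (c : Fin n → K) :
    ∑ x : Config G n, sqDev c x ≤ n * (Fintype.card (Config G n) : ℝ) := by
  have hn0 : (0 : ℝ) < n := by exact_mod_cast hn
  have hQ := lt_of_lt_of_le one_pos (one_le_card (G := G))
  have h1 : ∑ i : Fin n, ∑ g : G, ∑ x : Config G n, sqDev c (Function.update x i (x i * g)) =
      n * (Fintype.card G : ℝ) * ∑ x : Config G n, sqDev c x := by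
    simp only [fun (i : Fin n) (g : G) =>
      sum_update_mul i (fun _ : Config G n => g) (fun _ _ => rfl) (sqDev c)]
    simp
    ring
  have h2 : ∑ i : Fin n, ∑ g : G, ∑ x : Config G n, sqDev c (Function.update x i (x i * g)) ≤
      ∑ x : Config G n, (n * (Fintype.card G : ℝ) * (sqDev c x + 2)
        - 2 * Fintype.card G * sqDev c x) := by
    rw [Finset.sum_congr rfl fun i _ => Finset.sum_comm, Finset.sum_comm]
    refine Finset.sum_le_sum fun x _ => ?_
    calc ∑ i, ∑ g, sqDev c (Function.update x i (x i * g))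
        ≤ ∑ i, ∑ g, (sqDev c x + 2 + 2 * dev c x (c i) (x i * g) - 2 * dev c x (c i) (x i)) := by
          refine Finset.sum_le_sum fun i _ => Finset.sum_le_sum fun g _ => ?_
          have := sqDev_update_le c x i (x i * g)
          linarith
      _ = _ := by
          have : ∀ i, ∑ g, dev c x (c i) (x i * g) = 0 := fun i => by
            rw [sum_mul_left (x i) (fun b => dev c x (c i) b), sum_dev]
          simp only [Finset.sum_sub_distrib, Finset.sum_add_distrib, ← Finset.mul_sum, this]
          simp only [Finset.sum_const, Finset.card_univ, Fintype.card_fin, nsmul_eq_mul,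
            ← Finset.mul_sum, sum_dev_self]
          ring
  rw [h1, Finset.sum_sub_distrib, ← Finset.mul_sum, ← Finset.mul_sum, Finset.sum_add_distrib] at h2
  simp only [Finset.sum_const, Finset.card_univ, nsmul_eq_mul] at h2
  have h3 : (2 * (Fintype.card G : ℝ)) * ∑ x : Config G n, sqDev c x ≤
      (2 * (Fintype.card G : ℝ)) * (n * (Fintype.card (Config G n) : ℝ)) := by linarith
  exact le_of_mul_le_mul_left h3 (by positivity)

lemma dev_unit_eq_sum (c : Fin n → K) (x : Config G n) (g : G) :
    dev (fun _ => ()) x () g = ∑ k, dev c x k g := by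
  unfold dev
  rw [Finset.sum_comm]
  exact Finset.sum_congr rfl fun i _ => by simp

lemma sqDev_unit_le (c : Fin n → K) (x : Config G n) :
    sqDev (fun _ => ()) x ≤ Fintype.card K * sqDev c x := by
  unfold sqDev
  rw [Fintype.sum_unique, Finset.sum_comm, Finset.mul_sum]
  refine Finset.sum_le_sum fun g _ => ?_
  have := dev_unit_eq_sum c x g
  rw [show (default : Unit) = () from rfl, this]
  exact sq_sum_le_card_mul_sum_sq

lemma absDev_sq_le (x : Config G n) :
    absDev x ^ 2 ≤ Fintype.card G * sqDev (fun _ => ()) x := by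
  have h : sqDev (fun _ => ()) x = ∑ b, dev (fun _ => ()) x () b ^ 2 := Fintype.sum_unique _
  rw [h]
  unfold absDev
  refine sq_sum_le_card_mul_sum_sq.trans_eq ?_
  simp [sq_abs]

lemma absDev_le (x : Config G n) : absDev x ≤ 2 * n := by
  unfold absDev
  have hQ := card_ne_zero' (G := G)
  calc ∑ g, |dev (fun _ => ()) x () g|
      ≤ ∑ g, ∑ i, ((if x i = g then 1 else 0) + 1 / (Fintype.card G : ℝ)) := by
        refine Finset.sum_le_sum fun g _ => ?_
        unfold dev
        refine (Finset.abs_sum_le_sum_abs _ _).trans (Finset.sum_le_sum fun i _ => ?_)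
        have h3 : 0 ≤ 1 / (Fintype.card G : ℝ) := by positivity
        rw [if_pos rfl]
        split_ifs <;> rw [abs_le] <;> constructor <;> linarith
    _ = 2 * n := by
        rw [Finset.sum_comm]
        simp only [Finset.sum_add_distrib]
        simp [hQ]
        ring

lemma dev_unit_eq (x : Config G n) (g : G) :
    dev (fun _ => ()) x () g = (nCount G x g : ℝ) - n / (Fintype.card G : ℝ) := by
  unfold dev nCount
  simp [Finset.sum_sub_distrib]
  ring

end Deviation

end PR

namespace PR

section Alignment

set_option linter.unusedSectionVars false

variable {G : Type} [Group G] [Fintype G] {n : ℕ} {K : Type} [Fintype K]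

/-- The number of sites at which two configurations differ. -/
def hdist (x y : Config G n) : ℕ := (Finset.univ.filter fun i => x i ≠ y i).card

lemma hdist_eq_sum (x y : Config G n) :
    (hdist x y : ℝ) = ∑ i, if x i ≠ y i then (1 : ℝ) else 0 := by
  unfold hdist
  rw [Finset.sum_boole]

lemma hdist_eq_zero {x y : Config G n} (h : hdist x y = 0) : x = y := by
  unfold hdist at h
  rw [Finset.card_eq_zero, Finset.filter_eq_empty_iff] at h
  funext i
  simpa using h (Finset.mem_univ i)

lemma hdist_update_update_le_of_ne {x y : Config G n} {i : Fin n} (hi : x i ≠ y i) (v w : G) :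
    hdist (Function.update x i v) (Function.update y i w) ≤ hdist x y := by
  refine Finset.card_le_card fun l hl => ?_
  rw [Finset.mem_filter] at hl ⊢
  refine ⟨hl.1, ?_⟩
  by_cases h : l = i
  · rwa [h]
  · simpa [h] using hl.2

lemma hdist_update_update_self (x y : Config G n) (i : Fin n) (v : G) :
    hdist (Function.update x i v) (Function.update y i v) ≤ hdist x y := by
  refine Finset.card_le_card fun l hl => ?_
  rw [Finset.mem_filter] at hl ⊢
  refine ⟨hl.1, ?_⟩
  by_cases h : l = i
  · subst h
    simp at hl
  · simpa [h] using hl.2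

lemma hdist_update_update_self_lt {x y : Config G n} {i : Fin n} (hi : x i ≠ y i) (v : G) :
    hdist (Function.update x i v) (Function.update y i v) < hdist x y := by
  refine Finset.card_lt_card (Finset.ssubset_iff_subset_ne.2 ⟨fun l hl => ?_, fun h => ?_⟩)
  · rw [Finset.mem_filter] at hl ⊢
    refine ⟨hl.1, ?_⟩
    by_cases h : l = i
    · subst h
      simp at hl
    · simpa [h] using hl.2
  · have : i ∈ Finset.univ.filter fun l => x l ≠ y l := by simp [hi]
    rw [← h] at this
    simp at this

lemma hdist_update_update_le (x y : Config G n) (i : Fin n) (v w : G) :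
    hdist (Function.update x i v) (Function.update y i w) ≤ hdist x y + 1 := by
  refine le_trans ?_ (Finset.card_insert_le i (Finset.univ.filter fun i => x i ≠ y i))
  refine Finset.card_le_card fun l hl => ?_
  rw [Finset.mem_filter] at hl
  rw [Finset.mem_insert, Finset.mem_filter]
  by_cases h : l = i
  · exact Or.inl h
  · exact Or.inr ⟨hl.1, by simpa [h] using hl.2⟩

lemma hdist_comp_swap_lt {x z : Config G n} {i j : Fin n} (hi : x i ≠ z i) (hj : x j ≠ z j)
    (hij : z j = x i) : hdist x (z ∘ Equiv.swap i j) < hdist x z := by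
  refine Finset.card_lt_card (Finset.ssubset_iff_subset_ne.2 ⟨fun l hl => ?_, fun h => ?_⟩)
  · rw [Finset.mem_filter] at hl ⊢
    refine ⟨hl.1, ?_⟩
    by_cases h1 : l = i
    · rwa [h1]
    · by_cases h2 : l = j
      · rwa [h2]
      · simpa [Equiv.swap_apply_of_ne_of_ne h1 h2] using hl.2
  · have : i ∈ Finset.univ.filter fun l => x l ≠ z l := by simp [hi]
    rw [← h] at this
    simp [hij] at this

lemma dev_comp_perm (c : Fin n → K) (ρ : Equiv.Perm (Fin n)) (hρ : ∀ i, c (ρ i) = c i)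
    (y : Config G n) : dev c (y ∘ ρ) = dev c y := by
  funext k b
  unfold dev
  refine Eq.trans (Finset.sum_congr rfl fun i _ => ?_) (Equiv.sum_comp ρ _)
  simp [hρ]

lemma exists_perm_hdist_le (c : Fin n → K) (x y : Config G n) :
    ∃ ρ : Equiv.Perm (Fin n), (∀ i, c (ρ i) = c i) ∧
      (hdist x (y ∘ ρ) : ℝ) ≤ ∑ k, ∑ b, |dev c x k b - dev c y k b| := by
  obtain ⟨ρ, hρ, hmin⟩ := Finset.exists_min_image
    (Finset.univ.filter fun ρ : Equiv.Perm (Fin n) => ∀ i, c (ρ i) = c i)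
    (fun ρ => hdist x (y ∘ ρ)) ⟨1, by simp⟩
  rw [Finset.mem_filter] at hρ
  refine ⟨ρ, hρ.2, ?_⟩
  rw [← dev_comp_perm c ρ hρ.2 y]
  set z : Config G n := y ∘ ρ with hz
  have hswap : ∀ i j, c i = c j → x i ≠ z i → x j ≠ z j → z j ≠ x i := by
    intro i j hc hi hj hij
    have h1 := hdist_comp_swap_lt hi hj hij
    have h2 := hmin ((Equiv.swap i j).trans ρ) (by
      rw [Finset.mem_filter]
      refine ⟨Finset.mem_univ _, fun l => ?_⟩
      rw [Equiv.trans_apply, hρ.2]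
      by_cases h1 : l = i
      · simp [h1, hc]
      · by_cases h2 : l = j
        · simp [h2, hc]
        · rw [Equiv.swap_apply_of_ne_of_ne h1 h2])
    exact absurd h1 (not_lt.2 h2)
  have hcard : (hdist x z : ℝ) =
      ∑ k, ∑ b, ∑ i, if c i = k ∧ x i = b ∧ z i ≠ b then (1 : ℝ) else 0 := by
    rw [hdist_eq_sum, Finset.sum_congr rfl fun k _ => Finset.sum_comm, Finset.sum_comm]
    refine Finset.sum_congr rfl fun i _ => ?_
    rw [Finset.sum_eq_single (c i), Finset.sum_eq_single (x i)]
    · by_cases h : x i = z i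
      · simp [h]
      · simp [h, Ne.symm h]
    · intro b _ hb
      simp [Ne.symm hb]
    · simp
    · intro k _ hk
      simp [Ne.symm hk]
    · simp
  rw [hcard]
  refine Finset.sum_le_sum fun k _ => Finset.sum_le_sum fun b _ => ?_
  have hdiff : dev c x k b - dev c z k b =
      (∑ i, if c i = k ∧ x i = b ∧ z i ≠ b then (1 : ℝ) else 0) -
        ∑ i, if c i = k ∧ z i = b ∧ x i ≠ b then (1 : ℝ) else 0 := by
    unfold dev
    rw [← Finset.sum_sub_distrib, ← Finset.sum_sub_distrib]
    refine Finset.sum_congr rfl fun i _ => ?_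
    by_cases h1 : c i = k <;> by_cases h2 : x i = b <;> by_cases h3 : z i = b <;>
      (simp [h1, h2, h3]; try ring)
  rw [hdiff]
  by_cases hA : ∃ i, c i = k ∧ x i = b ∧ z i ≠ b
  · obtain ⟨i, hi1, hi2, hi3⟩ := hA
    have hB : ∑ j, (if c j = k ∧ z j = b ∧ x j ≠ b then (1 : ℝ) else 0) = 0 := by
      refine Finset.sum_eq_zero fun j _ => if_neg ?_
      rintro ⟨hj1, hj2, hj3⟩
      refine hswap i j (hi1.trans hj1.symm) ?_ ?_ (hj2.trans hi2.symm)
      · rw [hi2]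
        exact Ne.symm hi3
      · rwa [hj2]
    rw [hB, sub_zero]
    exact le_abs_self _
  · have : ∑ i, (if c i = k ∧ x i = b ∧ z i ≠ b then (1 : ℝ) else 0) = 0 :=
      Finset.sum_eq_zero fun i _ => if_neg fun h => hA ⟨i, h⟩
    rw [this]
    exact abs_nonneg _

end Alignment

section Weights

set_option linter.unusedSectionVars false

variable {G : Type} [Group G] [Fintype G] {n : ℕ} {K : Type} [Fintype K]

/-- The probability that an update of site `i` produces the value `v`. -/
def wt (x : Config G n) (i : Fin n) (v : G) : ℝ :=
  (∑ j, ∑ ε, if j ≠ i then (if x i * signed ε (x j) = v then 1 else 0) else 0) /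
    (2 * ((n : ℝ) - 1))

lemma stepOp_eq_wt (f : Config G n → ℝ) (x : Config G n) :
    stepOp f x = (∑ i, ∑ v, wt x i v * f (Function.update x i v)) / n := by
  rw [stepOp_apply, mul_comm (n : ℝ), ← div_div]
  congr 1
  rw [Finset.sum_div]
  refine Finset.sum_congr rfl fun i _ => ?_
  simp only [wt, div_mul_eq_mul_div, ← Finset.sum_div]
  congr 1
  simp only [Finset.sum_mul]
  symm
  refine (Finset.sum_comm.trans (Finset.sum_congr rfl fun j _ => Finset.sum_comm)).trans ?_
  refine Finset.sum_congr rfl fun j _ => Finset.sum_congr rfl fun ε _ => ?_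
  by_cases h : j = i <;> simp [h]

lemma wt_nonneg (hn : 2 ≤ n) (x : Config G n) (i : Fin n) (v : G) : 0 ≤ wt x i v := by
  have hn' : (2 : ℝ) ≤ n := by exact_mod_cast hn
  refine div_nonneg (Finset.sum_nonneg fun j _ => Finset.sum_nonneg fun ε _ => ?_) (by linarith)
  split_ifs <;> norm_num

lemma sum_wt (hn : 2 ≤ n) (x : Config G n) (i : Fin n) : ∑ v, wt x i v = 1 := by
  have hn' : (2 : ℝ) ≤ n := by exact_mod_cast hn
  have h0 : 2 * ((n : ℝ) - 1) ≠ 0 := by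
    have : 0 < (n : ℝ) - 1 := by linarith
    positivity
  unfold wt
  rw [← Finset.sum_div, div_eq_one_iff_eq h0]
  refine (Finset.sum_comm.trans (Finset.sum_congr rfl fun j _ => Finset.sum_comm)).trans ?_
  have := sum_ne_const i 1
  rw [mul_one] at this
  rw [← this]
  refine Finset.sum_congr rfl fun j _ => Finset.sum_congr rfl fun ε _ => ?_
  by_cases h : j = i <;> simp [h]

lemma sum_abs_wt_sub_le (hn : 2 ≤ n) {x y : Config G n} {i : Fin n} (hi : x i = y i) :
    (∑ v, |wt x i v - wt y i v|) / 2 ≤ hdist x y / ((n : ℝ) - 1) := by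
  have hn' : (2 : ℝ) ≤ n := by exact_mod_cast hn
  have hn1 : 0 < (n : ℝ) - 1 := by linarith
  have h1 : ∀ v, |wt x i v - wt y i v| ≤ (∑ j, ∑ ε, if x j ≠ y j then
      ((if x i * signed ε (x j) = v then 1 else 0) + (if y i * signed ε (y j) = v then 1 else 0))
      else 0) / (2 * ((n : ℝ) - 1)) := by
    intro v
    unfold wt
    rw [← sub_div, abs_div, abs_of_pos (by positivity : 0 < 2 * ((n : ℝ) - 1))]
    gcongr
    simp only [← Finset.sum_sub_distrib]
    refine (Finset.abs_sum_le_sum_abs _ _).trans (Finset.sum_le_sum fun j _ => ?_)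
    refine (Finset.abs_sum_le_sum_abs _ _).trans (Finset.sum_le_sum fun ε _ => ?_)
    by_cases hj : x j = y j
    · simp [hj, hi]
    · rw [if_pos hj]
      split_ifs <;> norm_num
  have h2 : ∑ v, |wt x i v - wt y i v| ≤ (4 * hdist x y) / (2 * ((n : ℝ) - 1)) := by
    refine (Finset.sum_le_sum fun v _ => h1 v).trans_eq ?_
    rw [← Finset.sum_div]
    congr 1
    rw [Finset.sum_comm, Finset.sum_congr rfl fun j _ => Finset.sum_comm]
    rw [hdist_eq_sum, Finset.mul_sum]
    refine Finset.sum_congr rfl fun j _ => ?_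
    by_cases hj : x j = y j
    · simp [hj]
    · simp [hj, Finset.sum_add_distrib]
      norm_num
  calc (∑ v, |wt x i v - wt y i v|) / 2 ≤ ((4 * hdist x y) / (2 * ((n : ℝ) - 1))) / 2 := by
        gcongr
    _ = _ := by
        field_simp
        ring

lemma signed_eq_iff (ε : Bool) (a b : G) : signed ε a = b ↔ a = signed ε b := by
  cases ε
  · simp [signed, inv_eq_iff_eq_inv]
  · simp [signed]

lemma abs_wt_sub_le (hn : 2 ≤ n) {x : Config G n} {r : ℝ}
    (hx : ∀ g, |dev (fun _ => ()) x () g| ≤ r) (i : Fin n) (v : G) :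
    |wt x i v - n / (Fintype.card G * ((n : ℝ) - 1))| ≤ (r + 1) / ((n : ℝ) - 1) := by
  have hn' : (2 : ℝ) ≤ n := by exact_mod_cast hn
  have hn1 : 0 < (n : ℝ) - 1 := by linarith
  have hQ := card_ne_zero' (G := G)
  have hw : wt x i v = (∑ ε, ((dev (fun _ => ()) x () (signed ε ((x i)⁻¹ * v)) +
      n / (Fintype.card G : ℝ)) - if signed ε (x i) = (x i)⁻¹ * v then 1 else 0)) /
      (2 * ((n : ℝ) - 1)) := by
    unfold wt
    congr 1
    rw [Finset.sum_comm]
    refine Finset.sum_congr rfl fun ε _ => ?_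
    rw [dev_unit_eq, nCount]
    have : ∀ j, (if j ≠ i then (if x i * signed ε (x j) = v then (1 : ℝ) else 0) else 0) =
        (if x j = signed ε ((x i)⁻¹ * v) then 1 else 0) -
          if j = i then (if signed ε (x i) = (x i)⁻¹ * v then 1 else 0) else 0 := by
      intro j
      by_cases h : j = i
      · subst h
        simp [signed_eq_iff]
      · simp [h, ← signed_eq_iff, eq_inv_mul_iff_mul_eq]
    rw [Finset.sum_congr rfl fun j _ => this j, Finset.sum_sub_distrib]
    simp
  have hterm : ∀ ε, |(dev (fun _ => ()) x () (signed ε ((x i)⁻¹ * v)) +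
      n / (Fintype.card G : ℝ)) - (if signed ε (x i) = (x i)⁻¹ * v then 1 else 0) -
      n / (Fintype.card G : ℝ)| ≤ r + 1 := by
    intro ε
    have := abs_le.1 (hx (signed ε ((x i)⁻¹ * v)))
    rw [abs_le]
    split_ifs <;> constructor <;> linarith
  have h0 := abs_le.1 (hterm true)
  have h1 := abs_le.1 (hterm false)
  have hc : n / (Fintype.card G * ((n : ℝ) - 1)) =
      (2 * (n / (Fintype.card G : ℝ))) / (2 * ((n : ℝ) - 1)) := by
    field_simp
  rw [hw, hc, ← sub_div, abs_div, abs_of_pos (by positivity : 0 < 2 * ((n : ℝ) - 1)),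
    div_le_div_iff₀ (by positivity) hn1]
  have h2 : |∑ ε, ((dev (fun _ => ()) x () (signed ε ((x i)⁻¹ * v)) +
      n / (Fintype.card G : ℝ)) - if signed ε (x i) = (x i)⁻¹ * v then 1 else 0) -
      2 * (n / (Fintype.card G : ℝ))| ≤ 2 * (r + 1) := by
    rw [Fintype.sum_bool, abs_le]
    constructor <;> linarith
  nlinarith

lemma abs_dev_unit_sub_le (x y : Config G n) (g : G) :
    |dev (fun _ => ()) x () g - dev (fun _ => ()) y () g| ≤ hdist x y := by
  unfold dev
  rw [← Finset.sum_sub_distrib]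
  refine (Finset.abs_sum_le_sum_abs _ _).trans ?_
  rw [hdist_eq_sum]
  refine Finset.sum_le_sum fun i _ => ?_
  rw [if_pos rfl, if_pos rfl]
  by_cases h : x i = y i
  · simp [h]
  · rw [if_pos h, abs_le]
    split_ifs <;> constructor <;> linarith

lemma sum_mul_sub_sum_mul_le {a b F F' : G → ℝ} {p q : ℝ}
    (ha : ∀ v, 0 ≤ a v) (hb : ∀ v, 0 ≤ b v) (hab : ∑ v, a v = ∑ v, b v)
    (hp : ∀ v, F v - F' v ≤ p) (hq : ∀ v w, F v - F' w ≤ q) :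
    ∑ v, a v * F v - ∑ v, b v * F' v ≤
      (∑ v, a v) * p + (q - p) * ((∑ v, |a v - b v|) / 2) := by
  obtain ⟨w, -, hw⟩ := Finset.exists_min_image (Finset.univ : Finset G) F' ⟨1, Finset.mem_univ _⟩
  have hmin : ∑ v, |a v - b v| / 2 = ∑ v, (a v - min (a v) (b v)) := by
    have h1 : ∑ v, |a v - b v| / 2 =
        ∑ v, ((a v - min (a v) (b v)) + ((b v - a v) / 2)) := by
      refine Finset.sum_congr rfl fun v _ => ?_
      rcases le_total (a v) (b v) with h | h
      · rw [min_eq_left h, abs_of_nonpos (by linarith)]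
        ring
      · rw [min_eq_right h, abs_of_nonneg (by linarith)]
        ring
    rw [h1, Finset.sum_add_distrib, ← Finset.sum_div, Finset.sum_sub_distrib (f := b), hab]
    simp
  have hsm : ∑ v, (b v - min (a v) (b v)) = ∑ v, (a v - min (a v) (b v)) := by
    rw [Finset.sum_sub_distrib, Finset.sum_sub_distrib, hab]
  rw [Finset.sum_div, hmin]
  have h1 : ∑ v, (a v - min (a v) (b v)) * F v ≤ (∑ v, (a v - min (a v) (b v))) * (q + F' w) := by
    rw [Finset.sum_mul]
    refine Finset.sum_le_sum fun v _ => mul_le_mul_of_nonneg_left ?_ (by simp)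
    linarith [hq v w]
  have h2 : (∑ v, (b v - min (a v) (b v))) * F' w ≤ ∑ v, (b v - min (a v) (b v)) * F' v := by
    rw [Finset.sum_mul]
    refine Finset.sum_le_sum fun v _ => mul_le_mul_of_nonneg_left (hw v (Finset.mem_univ v))
      (by simp)
  have h3 : ∑ v, min (a v) (b v) * (F v - F' v) ≤ (∑ v, min (a v) (b v)) * p := by
    rw [Finset.sum_mul]
    exact Finset.sum_le_sum fun v _ => mul_le_mul_of_nonneg_left (hp v) (le_min (ha v) (hb v))
  have h4 : ∑ v, a v * F v - ∑ v, b v * F' v = ∑ v, min (a v) (b v) * (F v - F' v) +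
      ∑ v, (a v - min (a v) (b v)) * F v - ∑ v, (b v - min (a v) (b v)) * F' v := by
    rw [← Finset.sum_sub_distrib, ← Finset.sum_add_distrib, ← Finset.sum_sub_distrib]
    exact Finset.sum_congr rfl fun v _ => by ring
  have h5 : ∑ v, min (a v) (b v) = ∑ v, a v - ∑ v, (a v - min (a v) (b v)) := by
    rw [Finset.sum_sub_distrib]
    ring
  rw [hsm] at h2
  rw [h5] at h3
  rw [h4]
  nlinarith

lemma sum_mul_sub_sum_mul_le_of_swap {a b F F' : G → ℝ} {p₀ p q γ : ℝ} {u w : G} (huw : u ≠ w)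
    (hγ : 0 ≤ γ)
    (ha : ∀ v, 0 ≤ a v) (hb : ∀ v, 0 ≤ b v) (hab : ∑ v, a v = ∑ v, b v)
    (hau : γ ≤ a u) (haw : γ ≤ a w) (hbu : γ ≤ b u) (hbw : γ ≤ b w)
    (hp₀ : F w - F' u ≤ p₀) (hp : ∀ v, F v - F' v ≤ p) (hq : ∀ v w, F v - F' w ≤ q) :
    ∑ v, a v * F v - ∑ v, b v * F' v ≤
      (∑ v, a v) * p + (q - p) * ((∑ v, |a v - b v|) / 2) + γ * (q - 2 * p + p₀) := by
  have key : ∀ H : G → ℝ, ∑ v, ((if v = u then γ else 0) + (if v = w then γ else 0)) * H v =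
      γ * H u + γ * H w := by
    intro H
    simp [add_mul, Finset.sum_add_distrib]
  have hpos : ∀ a : G → ℝ, (∀ v, 0 ≤ a v) → γ ≤ a u → γ ≤ a w →
      ∀ v, 0 ≤ a v - ((if v = u then γ else 0) + (if v = w then γ else 0)) := by
    intro a ha hau haw v
    by_cases h1 : v = u
    · subst h1
      simp [huw, hau]
    · by_cases h2 : v = w
      · subst h2
        simp [h1, haw]
      · simp [h1, h2, ha v]
  have hsum : ∑ v, ((if v = u then γ else 0) + (if v = w then γ else 0)) = 2 * γ := by
    have := key fun _ => 1
    simp only [mul_one] at this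
    rw [this]
    ring
  have hmain := sum_mul_sub_sum_mul_le (hpos a ha hau haw) (hpos b hb hbu hbw)
    (by rw [Finset.sum_sub_distrib, Finset.sum_sub_distrib, hab]) hp hq
  simp only [sub_mul _ _ (F _), sub_mul _ _ (F' _), sub_sub_sub_cancel_right] at hmain
  rw [Finset.sum_sub_distrib, Finset.sum_sub_distrib, Finset.sum_sub_distrib, key, key, hsum]
    at hmain
  have h1 : γ * (F u - F' w) ≤ γ * q := mul_le_mul_of_nonneg_left (hq u w) hγ
  have h2 : γ * (F w - F' u) ≤ γ * p₀ := mul_le_mul_of_nonneg_left hp₀ hγ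
  nlinarith

end Weights

end PR

namespace PR

section Contraction

set_option linter.unusedSectionVars false

variable {G : Type} [Group G] [Fintype G] {n : ℕ} {K : Type} [Fintype K]

lemma hdist_swap_lt {x y : Config G n} {i j : Fin n} (hi : x i = y i) (hj : x j ≠ y j) :
    hdist (Function.update x i (y j)) (Function.update y i (x j) ∘ Equiv.swap i j) <
      hdist x y := by
  have hij : j ≠ i := by
    rintro rfl
    exact hj hi
  refine Finset.card_lt_card (Finset.ssubset_iff_subset_ne.2 ⟨fun l hl => ?_, fun h => ?_⟩)
  · rw [Finset.mem_filter] at hl ⊢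
    refine ⟨hl.1, ?_⟩
    have hl2 := hl.2
    by_cases h1 : l = i
    · subst h1
      simp [hij] at hl2
    · by_cases h2 : l = j
      · rwa [h2]
      · simpa [Equiv.swap_apply_of_ne_of_ne h1 h2, h1] using hl2
  · have : j ∈ Finset.univ.filter fun l => x l ≠ y l := by simp [hj]
    rw [← h] at this
    simp [hij] at this

lemma stepOp_sub_stepOp_le (hn : 2 ≤ n) {c : Fin n → K} {f W : Config G n → ℝ}
    (hf : ∀ ρ : Equiv.Perm (Fin n), (∀ i, c (ρ i) = c i) → ∀ x, f (x ∘ ρ) = f x)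
    {x y : Config G n} {B₀ B₁ B₂ η γ κ : ℝ}
    (h₀ : ∀ x' y' : Config G n, hdist x' y' < hdist x y → f x' - f y' - W x' ≤ B₀)
    (h₁ : ∀ x' y' : Config G n, hdist x' y' ≤ hdist x y → f x' - f y' - W x' ≤ B₁)
    (h₂ : ∀ x' y' : Config G n, hdist x' y' ≤ hdist x y + 1 → f x' - f y' - W x' ≤ B₂)
    (h01 : B₀ ≤ B₁) (h12 : B₁ ≤ B₂) (hconc : B₂ - 2 * B₁ + B₀ ≤ 0)
    (hη : ∀ i, (∑ v, |wt x i v - wt y i v|) / 2 ≤ η) (hγ : 0 ≤ γ)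
    (hγx : ∀ i v, γ ≤ wt x i v) (hγy : ∀ i v, γ ≤ wt y i v) {i₀ : Fin n} (hi₀ : x i₀ ≠ y i₀)
    (hκ : κ * n ≤ (Finset.univ.filter fun i => x i = y i ∧ c i = c i₀).card) :
    stepOp f x - stepOp f y - stepOp W x ≤ B₁ - hdist x y / n * (1 - η) * (B₁ - B₀) +
      hdist x y / n * (B₂ - B₁) + κ * γ * (B₂ - 2 * B₁ + B₀) := by
  have hn' : (2 : ℝ) ≤ n := by exact_mod_cast hn
  have hn0 : 0 < (n : ℝ) := by linarith
  have hn1 : 0 < (n : ℝ) - 1 := by linarith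
  have hd1 : (1 : ℝ) ≤ hdist x y := by
    have : 0 < hdist x y := Finset.card_pos.2 ⟨i₀, by simp [hi₀]⟩
    exact_mod_cast this
  have hdn : (hdist x y : ℝ) ≤ n := by
    have : hdist x y ≤ n := (Finset.card_le_univ _).trans_eq (by simp)
    exact_mod_cast this
  have hsite : ∀ i, (∑ v, wt x i v * (f (Function.update x i v) - W (Function.update x i v)) -
      ∑ v, wt y i v * f (Function.update y i v)) ≤
      (B₁ + (B₂ - B₁) * (hdist x y / ((n : ℝ) - 1))) +
      (if x i ≠ y i then B₀ + (B₁ - B₀) * η - (B₁ + (B₂ - B₁) * (hdist x y / ((n : ℝ) - 1)))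
        else 0) +
      (if x i = y i ∧ c i = c i₀ then γ * (B₂ - 2 * B₁ + B₀) else 0) := by
    intro i
    have hab : ∑ v, wt x i v = ∑ v, wt y i v := by rw [sum_wt hn, sum_wt hn]
    by_cases hi : x i = y i
    · have hd := sum_abs_wt_sub_le hn hi
      have hd' := mul_le_mul_of_nonneg_left hd (sub_nonneg.2 h12)
      have hp : ∀ v, f (Function.update x i v) - W (Function.update x i v) -
          f (Function.update y i v) ≤ B₁ := fun v => by
        have := h₁ _ _ (hdist_update_update_self x y i v)
        linarith
      have hq : ∀ v w, f (Function.update x i v) - W (Function.update x i v) -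
          f (Function.update y i w) ≤ B₂ := fun v w => by
        have := h₂ _ _ (hdist_update_update_le x y i v w)
        linarith
      by_cases hc : c i = c i₀
      · have hp₀ : f (Function.update x i (y i₀)) - W (Function.update x i (y i₀)) -
            f (Function.update y i (x i₀)) ≤ B₀ := by
          have h1 := h₀ _ _ (hdist_swap_lt hi hi₀)
          rw [hf (Equiv.swap i i₀) (fun l => by
            by_cases h1 : l = i
            · simp [h1, hc]
            · by_cases h2 : l = i₀
              · simp [h2, hc]
              · rw [Equiv.swap_apply_of_ne_of_ne h1 h2])] at h1
          linarith
        have := sum_mul_sub_sum_mul_le_of_swap hi₀ hγ (wt_nonneg hn x i) (wt_nonneg hn y i) hab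
          (hγx i _) (hγx i _) (hγy i _) (hγy i _) hp₀ hp hq
        rw [sum_wt hn, one_mul] at this
        simp only [hi, hc, ne_eq, not_true_eq_false, if_false, and_self, if_true]
        linarith
      · have := sum_mul_sub_sum_mul_le (wt_nonneg hn x i) (wt_nonneg hn y i) hab hp hq
        rw [sum_wt hn, one_mul] at this
        simp only [hi, hc, ne_eq, not_true_eq_false, if_false, and_false]
        linarith
    · have := sum_mul_sub_sum_mul_le (wt_nonneg hn x i) (wt_nonneg hn y i) hab
        (F := fun v => f (Function.update x i v) - W (Function.update x i v))
        (F' := fun v => f (Function.update y i v)) (p := B₀) (q := B₁)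
        (fun v => by
          have := h₀ _ _ (hdist_update_update_self_lt hi v)
          linarith)
        (fun v w => by
          have := h₁ _ _ (hdist_update_update_le_of_ne hi v w)
          linarith)
      rw [sum_wt hn, one_mul] at this
      have h3 := mul_le_mul_of_nonneg_left (hη i) (sub_nonneg.2 h01)
      simp only [hi, ne_eq, not_false_eq_true, if_true, false_and, if_false]
      linarith
  have hsum := Finset.sum_le_sum fun i (_ : i ∈ Finset.univ) => hsite i
  rw [Finset.sum_add_distrib, Finset.sum_add_distrib, ← Finset.sum_filter, ← Finset.sum_filter,
    Finset.sum_const, Finset.sum_const, Finset.sum_const, Finset.card_univ, Fintype.card_fin,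
    nsmul_eq_mul, nsmul_eq_mul, nsmul_eq_mul] at hsum
  have hL : stepOp f x - stepOp f y - stepOp W x =
      (∑ i, (∑ v, wt x i v * (f (Function.update x i v) - W (Function.update x i v)) -
        ∑ v, wt y i v * f (Function.update y i v))) / n := by
    rw [stepOp_eq_wt, stepOp_eq_wt, stepOp_eq_wt, ← sub_div, ← sub_div]
    congr 1
    rw [← Finset.sum_sub_distrib, ← Finset.sum_sub_distrib]
    refine Finset.sum_congr rfl fun i _ => ?_
    simp only [mul_sub, Finset.sum_sub_distrib]
    ring
  have hcard : ((Finset.univ.filter fun i => x i ≠ y i).card : ℝ) = hdist x y := rfl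
  rw [hcard] at hsum
  have h3 := mul_le_mul_of_nonpos_right hκ (mul_nonpos_of_nonneg_of_nonpos hγ hconc)
  have h4 : ((n : ℝ) - hdist x y) * (hdist x y / ((n : ℝ) - 1)) ≤ hdist x y := by
    rw [mul_div_assoc', div_le_iff₀ hn1]
    nlinarith
  have h5 := mul_le_mul_of_nonneg_left h4 (sub_nonneg.2 h12)
  rw [hL, div_le_iff₀ hn0]
  have h6 : (B₁ - hdist x y / n * (1 - η) * (B₁ - B₀) +
      hdist x y / n * (B₂ - B₁) + κ * γ * (B₂ - 2 * B₁ + B₀)) * n =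
      B₁ * n - hdist x y * (1 - η) * (B₁ - B₀) + hdist x y * (B₂ - B₁) +
        κ * n * (γ * (B₂ - 2 * B₁ + B₀)) := by
    field_simp
  rw [h6]
  refine hsum.trans ?_
  linarith

end Contraction

end PR

namespace PR

section Coupling

set_option linter.unusedSectionVars false

variable {G : Type} [Group G] [Fintype G] {n : ℕ} {K : Type} [Fintype K]

/-- The squared deviation of the counts of a configuration from uniformity. -/
def unitSqDev (x : Config G n) : ℝ := sqDev (fun _ => ()) x

lemma unitSqDev_nonneg (x : Config G n) : 0 ≤ unitSqDev x := sqDev_nonneg _ _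

/-- A supermartingale bounding the probability that the counts leave a neighbourhood of
uniformity of radius `r` within `t` steps. -/
def exitBound (n : ℕ) (r : ℝ) (t : ℕ) (x : Config G n) : ℝ :=
  (1 + 8 / (n : ℝ)) ^ t * (unitSqDev x + 6 * t) / r ^ 2

lemma exitBound_nonneg (r : ℝ) (t : ℕ) (x : Config G n) : 0 ≤ exitBound n r t x := by
  have := unitSqDev_nonneg x
  unfold exitBound
  positivity

lemma one_le_exitBound {r : ℝ} (hr : 0 < r) (t : ℕ) {x : Config G n} (hx : r ^ 2 ≤ unitSqDev x) :
    1 ≤ exitBound n r t x := by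
  unfold exitBound
  rw [le_div_iff₀ (by positivity), one_mul]
  have h1 : (1 : ℝ) ≤ (1 + 8 / (n : ℝ)) ^ t := one_le_pow₀ (by
    have : 0 ≤ 8 / (n : ℝ) := by positivity
    linarith)
  have h2 : r ^ 2 ≤ unitSqDev x + 6 * t := by
    have : (0 : ℝ) ≤ 6 * t := by positivity
    linarith
  nlinarith [sq_nonneg r]

lemma stepOp_exitBound_le (hn : 2 ≤ n) {r : ℝ} (hr : 0 < r) (t : ℕ) (x : Config G n) :
    stepOp (exitBound n r t) x ≤ exitBound n r (t + 1) x := by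
  have hn' : (2 : ℝ) ≤ n := by exact_mod_cast hn
  have hn0 : 0 < (n : ℝ) := by linarith
  have hn1 : 0 < (n : ℝ) - 1 := by linarith
  have hY := unitSqDev_nonneg x
  have h1 : stepOp (unitSqDev (n := n)) x ≤ (1 + 8 / (n : ℝ)) * unitSqDev x + 6 := by
    refine (stepOp_sqDev_le hn _ x).trans ?_
    have h2 : absDev x / n ≤ 2 := by
      rw [div_le_iff₀ hn0]
      exact absDev_le x
    have h3 : 2 * (absDev x / n) / ((n : ℝ) - 1) ≤ 8 / n := by
      rw [div_le_div_iff₀ hn1 hn0]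
      nlinarith
    have h4 : 0 ≤ 2 / (n : ℝ) := by positivity
    have h5 : 1 - 2 / (n : ℝ) + 2 * (absDev x / n) / ((n : ℝ) - 1) ≤ 1 + 8 / (n : ℝ) := by linarith
    have := mul_le_mul_of_nonneg_left h5 hY
    unfold unitSqDev at this ⊢
    linarith
  have h2 : exitBound (G := G) n r t = fun x => ((1 + 8 / (n : ℝ)) ^ t / r ^ 2) *
      (unitSqDev x + 6 * t) := by
    funext x
    unfold exitBound
    ring
  have h8 : 0 ≤ 8 / (n : ℝ) := by positivity
  rw [h2, stepOp_mul_left, stepOp_add, stepOp_const hn]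
  calc ((1 + 8 / (n : ℝ)) ^ t / r ^ 2) * (stepOp unitSqDev x + 6 * t)
      ≤ ((1 + 8 / (n : ℝ)) ^ t / r ^ 2) * ((1 + 8 / (n : ℝ)) * (unitSqDev x + 6 * (t + 1))) := by
        gcongr
        have : (0 : ℝ) ≤ t := by positivity
        nlinarith
    _ = _ := by
        unfold exitBound
        push_cast
        ring

lemma abs_dev_le_of_unitSqDev_le {r : ℝ} (hr : 0 ≤ r) {x : Config G n}
    (hx : unitSqDev x ≤ r ^ 2) (g : G) : |dev (fun _ => ()) x () g| ≤ r := by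
  refine abs_le_of_sq_le_sq ?_ hr
  refine le_trans ?_ hx
  unfold unitSqDev sqDev
  rw [Fintype.sum_unique]
  exact Finset.single_le_sum (f := fun g => dev (fun _ => ()) x () g ^ 2)
    (fun _ _ => sq_nonneg _) (Finset.mem_univ g)

lemma le_wt (hn : 2 ≤ n) {x : Config G n} {r : ℝ}
    (hx : ∀ g, |dev (fun _ => ()) x () g| ≤ r) (hr : r + 1 ≤ n / (2 * (Fintype.card G : ℝ)))
    (i : Fin n) (v : G) : 1 / (2 * (Fintype.card G : ℝ)) ≤ wt x i v := by
  have hn' : (2 : ℝ) ≤ n := by exact_mod_cast hn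
  have hn1 : 0 < (n : ℝ) - 1 := by linarith
  have hQ : 0 < (Fintype.card G : ℝ) := by exact_mod_cast Fintype.card_pos
  have h1 := (abs_le.1 (abs_wt_sub_le hn hx i v)).1
  have h2 : (r + 1) / ((n : ℝ) - 1) ≤ n / (2 * (Fintype.card G : ℝ)) / ((n : ℝ) - 1) := by
    gcongr
  have h3 : n / ((Fintype.card G : ℝ) * ((n : ℝ) - 1)) -
      n / (2 * (Fintype.card G : ℝ)) / ((n : ℝ) - 1) =
      1 / (2 * (Fintype.card G : ℝ)) * (n / ((n : ℝ) - 1)) := by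
    field_simp
    norm_num
  have h4 : 1 ≤ n / ((n : ℝ) - 1) := by
    rw [le_div_iff₀ hn1]
    linarith
  have h5 : 1 / (2 * (Fintype.card G : ℝ)) * 1 ≤
      1 / (2 * (Fintype.card G : ℝ)) * (n / ((n : ℝ) - 1)) := by
    gcongr
  linarith

lemma half_sum_abs_wt_sub_le (hn : 2 ≤ n) {x y : Config G n} {r : ℝ}
    (hx : ∀ g, |dev (fun _ => ()) x () g| ≤ r) (hy : ∀ g, |dev (fun _ => ()) y () g| ≤ r)
    (i : Fin n) : (∑ v, |wt x i v - wt y i v|) / 2 ≤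
      Fintype.card G * (r + 1) / ((n : ℝ) - 1) := by
  have : ∀ v, |wt x i v - wt y i v| ≤ 2 * ((r + 1) / ((n : ℝ) - 1)) := by
    intro v
    have h1 := abs_le.1 (abs_wt_sub_le hn hx i v)
    have h2 := abs_le.1 (abs_wt_sub_le hn hy i v)
    rw [abs_le]
    constructor <;> linarith
  have h := Finset.sum_le_sum fun v (_ : v ∈ Finset.univ) => this v
  rw [Finset.sum_const, Finset.card_univ, nsmul_eq_mul] at h
  rw [mul_div_assoc]
  linarith

lemma mul_two_mul_sub_mono {d e h : ℕ} (hde : d ≤ e) (he : e ≤ h) :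
    (d : ℝ) * (2 * h - d) ≤ e * (2 * h - e) := by
  have h1 : (d : ℝ) ≤ e := by exact_mod_cast hde
  have h2 : (e : ℝ) ≤ h := by exact_mod_cast he
  nlinarith

set_option maxHeartbeats 1000000 in
lemma mul_iterate_stepOp_sub_le (hn : 2 ≤ n) {c : Fin n → K} {f : Config G n → ℝ}
    (hf0 : ∀ x, 0 ≤ f x) (hf1 : ∀ x, f x ≤ 1)
    (hf : ∀ ρ : Equiv.Perm (Fin n), (∀ i, c (ρ i) = c i) → ∀ x, f (x ∘ ρ) = f x)
    {h : ℕ} (hh : 1 ≤ h) {r η : ℝ} (hr : 0 < r)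
    (hη : Fintype.card G * (r + h + 1) / ((n : ℝ) - 1) ≤ η)
    (hrn : r + h + 1 ≤ n / (2 * (Fintype.card G : ℝ)))
    (hhη : 2 * (h : ℝ) ^ 2 * η / n ≤ 1 / (4 * (Fintype.card G : ℝ) ^ 2))
    (hc : ∀ k, n / (2 * (Fintype.card G : ℝ)) + h ≤
      (Finset.univ.filter fun i => c i = c k).card) (t : ℕ) :
    ∀ x y : Config G n, hdist x y ≤ h →
      t * ((stepOp^[t] f) x - (stepOp^[t] f) y - exitBound n r t x) ≤
      (t / (h : ℝ) ^ 2 + 4 * (Fintype.card G : ℝ) ^ 2) *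
        (hdist x y * (2 * h - hdist x y)) := by
  have hn' : (2 : ℝ) ≤ n := by exact_mod_cast hn
  have hn0 : 0 < (n : ℝ) := by linarith
  have hn1 : 0 < (n : ℝ) - 1 := by linarith
  have hQ : 0 < (Fintype.card G : ℝ) := by exact_mod_cast Fintype.card_pos
  have hh0 : (0 : ℝ) < h := by exact_mod_cast hh
  induction t with
  | zero =>
    intro x y hxy
    have : (hdist x y : ℝ) ≤ h := by exact_mod_cast hxy
    have h2 : 0 ≤ 2 * (h : ℝ) - hdist x y := by linarith
    push_cast
    rw [zero_mul]
    positivity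
  | succ t ih =>
    intro x y hxy
    have hxyR : (hdist x y : ℝ) ≤ h := by exact_mod_cast hxy
    have hψ : 0 ≤ (hdist x y : ℝ) * (2 * h - hdist x y) :=
      mul_nonneg (by positivity) (by linarith)
    have hK : 0 ≤ (((t + 1 : ℕ) : ℝ) / (h : ℝ) ^ 2 + 4 * (Fintype.card G : ℝ) ^ 2) := by positivity
    have hW := exitBound_nonneg (n := n) r (t + 1) x
    have hF : (stepOp^[t + 1] f) x - (stepOp^[t + 1] f) y ≤ 1 := by
      have h1 := iterate_stepOp_le_one hn hf1 (t + 1) x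
      have h2 := iterate_stepOp_nonneg hf0 (t + 1) y
      linarith
    have ht : (0 : ℝ) ≤ ((t + 1 : ℕ) : ℝ) := by positivity
    by_cases hY : r ^ 2 ≤ unitSqDev x
    · have h1 := one_le_exitBound hr (t + 1) hY
      have h2 := mul_nonpos_of_nonneg_of_nonpos ht
        (by linarith : (stepOp^[t + 1] f) x - (stepOp^[t + 1] f) y - exitBound n r (t + 1) x ≤ 0)
      exact h2.trans (mul_nonneg hK hψ)
    rw [not_le] at hY
    rcases Nat.eq_or_lt_of_le hxy with hD | hD
    · rw [hD]
      have h1 : (((t + 1 : ℕ) : ℝ) / (h : ℝ) ^ 2 + 4 * (Fintype.card G : ℝ) ^ 2) *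
          (h * (2 * h - h)) = ((t + 1 : ℕ) : ℝ) + 4 * (Fintype.card G : ℝ) ^ 2 * (h : ℝ) ^ 2 := by
        field_simp
        ring
      rw [h1]
      have h2 := mul_le_mul_of_nonneg_left (by linarith : (stepOp^[t + 1] f) x -
        (stepOp^[t + 1] f) y - exitBound n r (t + 1) x ≤ 1) ht
      have : 0 ≤ 4 * (Fintype.card G : ℝ) ^ 2 * (h : ℝ) ^ 2 := by positivity
      linarith
    rcases Nat.eq_zero_or_pos (hdist x y) with hD0 | hD0
    · have := hdist_eq_zero hD0
      subst this
      have h2 := mul_nonpos_of_nonneg_of_nonpos ht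
        (by linarith : (stepOp^[t + 1] f) x - (stepOp^[t + 1] f) x - exitBound n r (t + 1) x ≤ 0)
      exact h2.trans (mul_nonneg hK hψ)
    obtain ⟨i₀, hi₀⟩ := Finset.card_pos.1 hD0
    simp only [Finset.mem_filter, Finset.mem_univ, true_and] at hi₀
    have hx := abs_dev_le_of_unitSqDev_le hr.le hY.le
    have hx' : ∀ g, |dev (fun _ => ()) x () g| ≤ r + h := fun g => (hx g).trans (by linarith)
    have hy : ∀ g, |dev (fun _ => ()) y () g| ≤ r + h := by
      intro g
      have h1 := abs_le.1 (hx g)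
      have h2 := abs_le.1 (abs_dev_unit_sub_le x y g)
      rw [abs_le]
      constructor <;> linarith
    have hκ : 1 / (2 * (Fintype.card G : ℝ)) * n ≤
        (Finset.univ.filter fun i => x i = y i ∧ c i = c i₀).card := by
      have h1 : (Finset.univ.filter fun i => c i = c i₀).card ≤
          (Finset.univ.filter fun i => x i = y i ∧ c i = c i₀).card + hdist x y := by
        refine (Finset.card_le_card fun i hi => ?_).trans (Finset.card_union_le _ _)
        rw [Finset.mem_union, Finset.mem_filter, Finset.mem_filter]
        rw [Finset.mem_filter] at hi
        by_cases hxi : x i = y i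
        · exact Or.inl ⟨hi.1, hxi, hi.2⟩
        · exact Or.inr ⟨hi.1, hxi⟩
      have h2 : ((Finset.univ.filter fun i => c i = c i₀).card : ℝ) ≤
          (Finset.univ.filter fun i => x i = y i ∧ c i = c i₀).card + hdist x y := by
        exact_mod_cast h1
      have h3 := hc i₀
      rw [one_div_mul_eq_div]
      linarith
    have hKt : 0 ≤ ((t : ℝ) / (h : ℝ) ^ 2 + 4 * (Fintype.card G : ℝ) ^ 2) := by positivity
    set Kt := ((t : ℝ) / (h : ℝ) ^ 2 + 4 * (Fintype.card G : ℝ) ^ 2) with hKt_def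
    have hstep := stepOp_sub_stepOp_le hn (c := c) (f := fun z => t * (stepOp^[t] f) z)
      (W := fun z => t * exitBound n r t z) (x := x) (y := y)
      (B₀ := Kt * (((hdist x y : ℝ) - 1) * (2 * h - ((hdist x y : ℝ) - 1))))
      (B₁ := Kt * ((hdist x y : ℝ) * (2 * h - hdist x y)))
      (B₂ := Kt * (((hdist x y : ℝ) + 1) * (2 * h - ((hdist x y : ℝ) + 1))))
      (η := η) (γ := 1 / (2 * (Fintype.card G : ℝ))) (κ := 1 / (2 * (Fintype.card G : ℝ)))
      (i₀ := i₀) ?_ ?_ ?_ ?_ ?_ ?_ ?_ ?_ ?_ ?_ ?_ hi₀ hκ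
    · rw [stepOp_mul_left, stepOp_mul_left, stepOp_mul_left] at hstep
      have hWs := mul_le_mul_of_nonneg_left (stepOp_exitBound_le hn hr t x)
        (Nat.cast_nonneg (α := ℝ) t)
      rw [Function.iterate_succ_apply'] at hF ⊢
      have hη0 : 0 ≤ η := le_trans (by positivity) hη
      have h4 : (hdist x y : ℝ) / n * (η * (2 * h - 2 * hdist x y + 1)) ≤
          1 / (4 * (Fintype.card G : ℝ) ^ 2) := by
        refine le_trans ?_ hhη
        rw [div_mul_eq_mul_div]
        refine div_le_div_of_nonneg_right ?_ hn0.le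
        have hD1 : (1 : ℝ) ≤ hdist x y := by exact_mod_cast hD0
        have : (hdist x y : ℝ) * (2 * h - 2 * hdist x y + 1) ≤ 2 * (h : ℝ) ^ 2 := by nlinarith
        nlinarith
      have h5 : Kt * (1 / (4 * (Fintype.card G : ℝ) ^ 2)) ≥ 1 := by
        have : Kt * (1 / (4 * (Fintype.card G : ℝ) ^ 2)) =
            (t : ℝ) / (h : ℝ) ^ 2 * (1 / (4 * (Fintype.card G : ℝ) ^ 2)) + 1 := by
          rw [hKt_def]
          field_simp
        rw [this]
        have : 0 ≤ (t : ℝ) / (h : ℝ) ^ 2 * (1 / (4 * (Fintype.card G : ℝ) ^ 2)) := by positivity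
        linarith
      have h6 := mul_le_mul_of_nonneg_left h4 hKt
      have h7 : 0 ≤ Kt * ((hdist x y : ℝ) / n) := by positivity
      have h8 : (1 / (2 * (Fintype.card G : ℝ))) * (1 / (2 * (Fintype.card G : ℝ))) =
          1 / (4 * (Fintype.card G : ℝ) ^ 2) := by
        field_simp
        norm_num
      rw [h8] at hstep
      have h9 : Kt * ((hdist x y : ℝ) * (2 * h - hdist x y)) ≤
          (((t + 1 : ℕ) : ℝ) / (h : ℝ) ^ 2 + 4 * (Fintype.card G : ℝ) ^ 2) *
            ((hdist x y : ℝ) * (2 * h - hdist x y)) := by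
        refine mul_le_mul_of_nonneg_right ?_ hψ
        rw [hKt_def]
        gcongr
        exact_mod_cast Nat.le_succ t
      refine le_trans ?_ h9
      push_cast
      linarith
    · intro ρ hρ z
      have : f = fun z => f (z ∘ ρ) := by
        funext z
        rw [hf ρ hρ]
      rw [iterate_stepOp_comp_perm, ← this]
    · intro x' y' hxy'
      have h1 := ih x' y' (by omega)
      have h2 : (hdist x' y' : ℝ) * (2 * h - hdist x' y') ≤
          ((hdist x y : ℝ) - 1) * (2 * h - ((hdist x y : ℝ) - 1)) := by
        have := mul_two_mul_sub_mono (d := hdist x' y') (e := hdist x y - 1) (h := h)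
          (by omega) (by omega)
        rwa [Nat.cast_sub (by omega), Nat.cast_one] at this
      have := mul_le_mul_of_nonneg_left h2 hKt
      linarith
    · intro x' y' hxy'
      have h1 := ih x' y' (by omega)
      have := mul_le_mul_of_nonneg_left (mul_two_mul_sub_mono hxy' hxy) hKt
      linarith
    · intro x' y' hxy'
      have h1 := ih x' y' (by omega)
      have := mul_le_mul_of_nonneg_left (mul_two_mul_sub_mono hxy' hD) hKt
      push_cast at this
      linarith
    · refine mul_le_mul_of_nonneg_left ?_ hKt
      nlinarith
    · refine mul_le_mul_of_nonneg_left ?_ hKt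
      have : (hdist x y : ℝ) + 1 ≤ h := by exact_mod_cast hD
      nlinarith
    · have : Kt * (((hdist x y : ℝ) + 1) * (2 * h - ((hdist x y : ℝ) + 1))) -
        2 * (Kt * ((hdist x y : ℝ) * (2 * h - hdist x y))) +
        Kt * (((hdist x y : ℝ) - 1) * (2 * h - ((hdist x y : ℝ) - 1))) = -2 * Kt := by ring
      rw [this]
      linarith
    · exact fun i => (half_sum_abs_wt_sub_le hn hx' hy i).trans hη
    · positivity
    · exact le_wt hn hx' hrn
    · exact le_wt hn hy hrn

end Coupling

end PR

namespace PR

section Smoothing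

set_option linter.unusedSectionVars false

variable {G : Type} [Group G] [Fintype G] {n : ℕ} {K : Type} [Fintype K]

lemma iterate_stepOp_sub_le (hn : 2 ≤ n) {c : Fin n → K} {f : Config G n → ℝ}
    (hf0 : ∀ x, 0 ≤ f x) (hf1 : ∀ x, f x ≤ 1)
    (hf : ∀ ρ : Equiv.Perm (Fin n), (∀ i, c (ρ i) = c i) → ∀ x, f (x ∘ ρ) = f x)
    {h : ℕ} (hh : 1 ≤ h) {r η : ℝ} (hr : 0 < r)
    (hη : Fintype.card G * (r + h + 1) / ((n : ℝ) - 1) ≤ η)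
    (hrn : r + h + 1 ≤ n / (2 * (Fintype.card G : ℝ)))
    (hhη : 2 * (h : ℝ) ^ 2 * η / n ≤ 1 / (4 * (Fintype.card G : ℝ) ^ 2))
    (hc : ∀ k, n / (2 * (Fintype.card G : ℝ)) + h ≤
      (Finset.univ.filter fun i => c i = c k).card) {t : ℕ} (ht : 1 ≤ t) (x y : Config G n) :
    (stepOp^[t] f) x - (stepOp^[t] f) y ≤
      (2 / h + 8 * (Fintype.card G : ℝ) ^ 2 * h / t) *
        (∑ k, ∑ b, |dev c x k b| + ∑ k, ∑ b, |dev c y k b|) + exitBound n r t x := by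
  obtain ⟨ρ, hρ, hxy⟩ := exists_perm_hdist_le c x y
  have hh0 : (0 : ℝ) < h := by exact_mod_cast hh
  have ht0 : (0 : ℝ) < t := by exact_mod_cast ht
  have hW := exitBound_nonneg (n := n) r t x
  have hD : (hdist x (y ∘ ρ) : ℝ) ≤ ∑ k, ∑ b, |dev c x k b| + ∑ k, ∑ b, |dev c y k b| := by
    refine hxy.trans ?_
    rw [← Finset.sum_add_distrib]
    refine Finset.sum_le_sum fun k _ => ?_
    rw [← Finset.sum_add_distrib]
    exact Finset.sum_le_sum fun b _ => abs_sub _ _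
  have hM : 0 ≤ 8 * (Fintype.card G : ℝ) ^ 2 * h / t := by positivity
  have hinv : (stepOp^[t] f) (y ∘ ρ) = (stepOp^[t] f) y := by
    have : f = fun z => f (z ∘ ρ) := by
      funext z
      rw [hf ρ hρ]
    rw [iterate_stepOp_comp_perm, ← this]
  refine le_trans ?_ (add_le_add_left (mul_le_mul_of_nonneg_left hD (by positivity)) _)
  rcases le_total (hdist x (y ∘ ρ)) h with hle | hle
  · have h1 := mul_iterate_stepOp_sub_le hn hf0 hf1 hf hh hr hη hrn hhη hc t x (y ∘ ρ) hle
    rw [hinv] at h1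
    have h2 : (hdist x (y ∘ ρ) : ℝ) * (2 * h - hdist x (y ∘ ρ)) ≤ hdist x (y ∘ ρ) * (2 * h) := by
      gcongr
      have : (0 : ℝ) ≤ hdist x (y ∘ ρ) := by positivity
      linarith
    have h3 := h1.trans (mul_le_mul_of_nonneg_left h2
      (by positivity : 0 ≤ t / (h : ℝ) ^ 2 + 4 * (Fintype.card G : ℝ) ^ 2))
    have h4 : (t / (h : ℝ) ^ 2 + 4 * (Fintype.card G : ℝ) ^ 2) *
        ((hdist x (y ∘ ρ) : ℝ) * (2 * h)) =
        t * ((2 / h + 8 * (Fintype.card G : ℝ) ^ 2 * h / t) * hdist x (y ∘ ρ)) := by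
      field_simp
      ring
    rw [h4] at h3
    have := le_of_mul_le_mul_left h3 ht0
    linarith
  · have h1 := iterate_stepOp_le_one hn hf1 t x
    have h2 := iterate_stepOp_nonneg hf0 t y
    have h3 : (1 : ℝ) ≤ 2 / h * hdist x (y ∘ ρ) := by
      have : (h : ℝ) ≤ hdist x (y ∘ ρ) := by exact_mod_cast hle
      rw [div_mul_eq_mul_div, le_div_iff₀ hh0]
      linarith
    have h4 : 0 ≤ 8 * (Fintype.card G : ℝ) ^ 2 * h / t * hdist x (y ∘ ρ) := by positivity
    rw [add_mul]
    linarith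

lemma sum_abs_dev_le (hn : 1 ≤ n) (c : Fin n → K) (x : Config G n) :
    ∑ k, ∑ b, |dev c x k b| ≤
      √n / 2 * (Fintype.card K * Fintype.card G + sqDev c x / n) := by
  have hn0 : (0 : ℝ) < n := by exact_mod_cast hn
  have hs := Real.sqrt_pos.2 hn0
  have hss := Real.mul_self_sqrt hn0.le
  have h1 : ∀ d : ℝ, |d| ≤ √n / 2 * (1 + d ^ 2 / n) := by
    intro d
    have h2 : √n / 2 * (1 + d ^ 2 / n) = (n + d ^ 2) / (2 * √n) := by
      rw [eq_div_iff (by positivity)]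
      calc √n / 2 * (1 + d ^ 2 / n) * (2 * √n) = (√n * √n) * (1 + d ^ 2 / n) := by ring
        _ = n + d ^ 2 := by
          rw [hss]
          field_simp
    rw [h2, le_div_iff₀ (by positivity), ← sq_abs d]
    nlinarith [sq_nonneg (|d| - √n)]
  refine (Finset.sum_le_sum fun k _ => Finset.sum_le_sum fun b _ => h1 (dev c x k b)).trans_eq ?_
  simp only [← Finset.mul_sum, Finset.sum_add_distrib, ← Finset.sum_div]
  simp [sqDev]

lemma sqrt_const_mul_le {β δ : ℝ} (hδ : 0 < δ) {m : ℝ} (hm : 0 ≤ m) (h : β / δ ^ 2 ≤ m) :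
    √(β * m) ≤ δ * m := by
  rw [div_le_iff₀ (by positivity)] at h
  refine Real.sqrt_le_iff.2 ⟨by positivity, ?_⟩
  nlinarith

lemma card_fiber_ge {σ : Config G n} (hn : 1 ≤ n)
    (hσ : σ ∈ SAst G n (1 / (5 * (Fintype.card G : ℝ) ^ 3))) (a : G) :
    4 * n / (5 * (Fintype.card G : ℝ)) ≤ nCount G σ a := by
  have hn0 : (0 : ℝ) < n := by exact_mod_cast hn
  have hQ := one_le_card (G := G)
  have h1 := Real.sqrt_le_iff.1 hσ.2
  have h2 := (Finset.single_le_sum (f := fun a : G => ((nCount G σ a : ℝ) / n -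
    1 / (Fintype.card G : ℝ)) ^ 2) (fun _ _ => sq_nonneg _) (Finset.mem_univ a)).trans h1.2
  have h3 := (abs_le.1 (abs_le_of_sq_le_sq h2 h1.1)).1
  have h4 : 1 / (5 * (Fintype.card G : ℝ) ^ 3) ≤ 1 / (5 * (Fintype.card G : ℝ)) := by
    gcongr
    nlinarith [sq_nonneg ((Fintype.card G : ℝ))]
  have h5 : 1 / (Fintype.card G : ℝ) - 1 / (5 * (Fintype.card G : ℝ)) =
      4 / (5 * (Fintype.card G : ℝ)) := by
    field_simp
    norm_num
  have h6 : 4 / (5 * (Fintype.card G : ℝ)) ≤ (nCount G σ a : ℝ) / n := by linarith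
  rw [le_div_iff₀ hn0] at h6
  rwa [div_mul_eq_mul_div] at h6

lemma exitBound_le {δ β : ℝ} (hδ : 0 < δ) (hn : 1 ≤ n) {t : ℕ}
    (ht : (t : ℝ) ≤ 2 * (β * n)) (c : Fin n → K) (x : Config G n) :
    exitBound n (δ * n) t x ≤ Real.exp (16 * β) *
      (Fintype.card K * (sqDev c x / n) + 12 * β) / (δ ^ 2 * n) := by
  have hn0 : (0 : ℝ) < n := by exact_mod_cast hn
  have h1 : (1 + 8 / (n : ℝ)) ^ t ≤ Real.exp (16 * β) := by
    calc (1 + 8 / (n : ℝ)) ^ t ≤ Real.exp (8 / n) ^ t := by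
          gcongr
          rw [add_comm]
          exact Real.add_one_le_exp _
      _ = Real.exp (t * (8 / n)) := (Real.exp_nat_mul _ _).symm
      _ ≤ _ := by
          rw [Real.exp_le_exp, mul_div_assoc', div_le_iff₀ hn0]
          linarith
  have h2 : unitSqDev x + 6 * t ≤ n * (Fintype.card K * (sqDev c x / n) + 12 * β) := by
    have h3 := sqDev_unit_le c x
    have h4 : n * (Fintype.card K * (sqDev c x / n) + 12 * β) =
        Fintype.card K * sqDev c x + 12 * (β * n) := by
      field_simp
    rw [h4]
    unfold unitSqDev
    linarith
  unfold exitBound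
  calc (1 + 8 / (n : ℝ)) ^ t * (unitSqDev x + 6 * t) / (δ * n) ^ 2
      ≤ Real.exp (16 * β) * (n * (Fintype.card K * (sqDev c x / n) + 12 * β)) / (δ * n) ^ 2 := by
        have := unitSqDev_nonneg x
        gcongr
    _ = _ := by
        field_simp

/-- A constant governing the smoothing phase. -/
def smoothConst (G : Type) [Fintype G] : ℝ :=
  (1 + 8 * (Fintype.card G : ℝ) ^ 2) * (2 * (Fintype.card G : ℝ) ^ 2 + 1) + 1

lemma iterate_stepOp_sub_average_le (G : Type) [Group G] [Fintype G] {β : ℝ} (hβ : 0 < β) :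
    ∀ᶠ n : ℕ in atTop, ∀ c ∈ SAst G n (1 / (5 * (Fintype.card G : ℝ) ^ 3)),
      ∀ f : Config G n → ℝ, (∀ x, 0 ≤ f x) → (∀ x, f x ≤ 1) →
      (∀ ρ : Equiv.Perm (Fin n), (∀ i, c (ρ i) = c i) → ∀ x, f (x ∘ ρ) = f x) →
      ∀ x, (stepOp^[⌈β * n⌉₊] f) x - (∑ y, f y) / (Fintype.card (Config G n) : ℝ) ≤
        smoothConst G / √β * (1 + sqDev c x / n) := by
  have hQ := one_le_card (G := G)
  have hQ0 : 0 < (Fintype.card G : ℝ) := by linarith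
  set Q := (Fintype.card G : ℝ) with hQdef
  obtain ⟨η, hη⟩ : ∃ η, η = 1 / (32 * β * Q ^ 2) := ⟨_, rfl⟩
  have hη0 : 0 < η := by
    rw [hη]
    positivity
  obtain ⟨δ, hδ⟩ : ∃ δ, δ = min (η / (4 * Q)) (1 / (4 * Q)) := ⟨_, rfl⟩
  have hδ0 : 0 < δ := by
    rw [hδ]
    positivity
  have hδη : δ ≤ η / (4 * Q) := hδ ▸ min_le_left _ _
  have hδQ : δ ≤ 1 / (4 * Q) := hδ ▸ min_le_right _ _
  have hsβ := Real.sqrt_pos.2 hβ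
  have hev : ∀ A : ℝ, ∀ᶠ n : ℕ in atTop, A ≤ n := fun A =>
    tendsto_natCast_atTop_atTop.eventually_ge_atTop A
  filter_upwards [hev 2, hev (1 / β), hev (β / (δ / 2) ^ 2), hev (2 / (δ / 2)),
    hev (Real.exp (16 * β) * (Q + 12 * β) / δ ^ 2 * √β)] with n hn2 hn1β hnβ hnδ hnE
  intro c hc f hf0 hf1 hf x
  have hn : 2 ≤ n := by exact_mod_cast hn2
  have hn0 : 0 < (n : ℝ) := by linarith
  have hn1 : 0 < (n : ℝ) - 1 := by linarith
  have hβn : 1 ≤ β * n := by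
    rw [div_le_iff₀ hβ] at hn1β
    linarith
  have hsn : 1 ≤ √(β * n) := Real.one_le_sqrt.2 hβn
  have hh1 : √(β * n) ≤ (⌈√(β * n)⌉₊ : ℝ) := Nat.le_ceil _
  have hh2 : (⌈√(β * n)⌉₊ : ℝ) < √(β * n) + 1 := Nat.ceil_lt_add_one (by linarith)
  have ht1 : β * n ≤ (⌈β * n⌉₊ : ℝ) := Nat.le_ceil _
  have ht2 : (⌈β * n⌉₊ : ℝ) < β * n + 1 := Nat.ceil_lt_add_one (by linarith)
  generalize ⌈√(β * n)⌉₊ = h at hh1 hh2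
  generalize ⌈β * n⌉₊ = t at ht1 ht2 ⊢
  have hδn : (h : ℝ) + 1 ≤ δ * n := by
    have h1 := sqrt_const_mul_le (by positivity : 0 < δ / 2) hn0.le hnβ
    rw [div_le_iff₀ (by positivity)] at hnδ
    linarith
  have hh0 : (0 : ℝ) < h := by linarith
  have ht0 : (0 : ℝ) < t := by linarith
  have hδn2 : δ * n + h + 1 ≤ 2 * (δ * n) := by linarith
  have hsq := Real.mul_self_sqrt (by linarith : 0 ≤ β * n)
  have hh3 : (h : ℝ) ≤ 2 * √(β * n) := by linarith
  have hmain := fun y => iterate_stepOp_sub_le hn hf0 hf1 hf (h := h) (r := δ * n) (η := η) (t := t)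
    (by exact_mod_cast hh0) (by positivity)
    (by
      rw [div_le_iff₀ hn1]
      have h1 : Q * (δ * n + h + 1) ≤ Q * (2 * (η / (4 * Q) * n)) := by
        gcongr
        refine hδn2.trans ?_
        gcongr
      have h2 : Q * (2 * (η / (4 * Q) * n)) = η * (n / 2) := by
        field_simp
        norm_num
      have h3 : η * (n / 2) ≤ η * (n - 1) := by
        gcongr
        linarith
      linarith)
    (by
      have h1 : 2 * (δ * n) ≤ 2 * (1 / (4 * Q) * n) := by gcongr
      have h2 : 2 * (1 / (4 * Q) * n) = n / (2 * Q) := by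
        field_simp
        norm_num
      linarith)
    (by
      have h1 : (h : ℝ) ^ 2 ≤ 4 * (β * n) := by nlinarith
      calc 2 * (h : ℝ) ^ 2 * η / n ≤ 2 * (4 * (β * n)) * η / n := by gcongr
        _ = 1 / (4 * Q ^ 2) := by
          rw [hη]
          field_simp
          norm_num
        _ ≤ _ := le_rfl)
    (by
      intro k
      have h1 := card_fiber_ge (by omega) hc (c k)
      have h2 : (h : ℝ) ≤ 1 / (4 * Q) * n := by
        have : δ * n ≤ 1 / (4 * Q) * n := by gcongr
        linarith
      have h3 : n / (2 * Q) + 1 / (4 * Q) * n ≤ 4 * n / (5 * Q) := by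
        have : 4 * n / (5 * Q) - (n / (2 * Q) + 1 / (4 * Q) * n) = n / (20 * Q) := by
          field_simp
          ring
        have : 0 ≤ n / (20 * Q) := by positivity
        linarith
      unfold nCount at h1
      linarith)
    (by exact_mod_cast ht0) x y
  have hM : 2 / h + 8 * Q ^ 2 * h / t ≤ (2 + 16 * Q ^ 2) / √(β * n) := by
    have h1 : 2 / (h : ℝ) ≤ 2 / √(β * n) := by gcongr
    have h2 : 8 * Q ^ 2 * h / t ≤ 8 * Q ^ 2 * (2 * √(β * n)) / (√(β * n) * √(β * n)) := by
      rw [hsq]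
      gcongr
    have h3 : 8 * Q ^ 2 * (2 * √(β * n)) / (√(β * n) * √(β * n)) = 16 * Q ^ 2 / √(β * n) := by
      field_simp
      norm_num
    rw [add_div]
    linarith
  have hpair : ∀ y, (stepOp^[t] f) x - (stepOp^[t] f) y ≤
      (1 + 8 * Q ^ 2) / √β * (2 * Q ^ 2 + sqDev c x / n + sqDev c y / n) +
        exitBound n (δ * n) t x := by
    intro y
    refine (hmain y).trans (add_le_add_left ?_ _)
    have hx := sum_abs_dev_le (by omega) c x
    have hy := sum_abs_dev_le (by omega) c y
    have hSx := sqDev_nonneg c x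
    have hSy := sqDev_nonneg c y
    calc (2 / h + 8 * Q ^ 2 * h / t) * (∑ k, ∑ b, |dev c x k b| + ∑ k, ∑ b, |dev c y k b|)
        ≤ ((2 + 16 * Q ^ 2) / √(β * n)) * (√n / 2 * (Q * Q + sqDev c x / n) +
          √n / 2 * (Q * Q + sqDev c y / n)) := by gcongr
      _ = _ := by
        have := Real.sqrt_pos.2 hn0
        rw [Real.sqrt_mul hβ.le]
        field_simp
        ring
  have hcard : 0 < (Fintype.card (Config G n) : ℝ) := by exact_mod_cast Fintype.card_pos
  have havg : (stepOp^[t] f) x - (∑ y, f y) / (Fintype.card (Config G n) : ℝ) ≤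
      (1 + 8 * Q ^ 2) / √β * (2 * Q ^ 2 + sqDev c x / n + 1) + exitBound n (δ * n) t x := by
    have h1 := Finset.sum_le_sum fun y (_ : y ∈ Finset.univ) => hpair y
    rw [Finset.sum_sub_distrib, Finset.sum_add_distrib, ← Finset.mul_sum, Finset.sum_add_distrib,
      Finset.sum_const, Finset.sum_const, Finset.sum_const, ← Finset.sum_div, Finset.card_univ,
      nsmul_eq_mul, nsmul_eq_mul, nsmul_eq_mul, sum_iterate_stepOp hn] at h1
    have h2 := sum_sqDev_le (G := G) (by omega : 1 ≤ n) c
    have h3 : (∑ y : Config G n, sqDev c y) / n ≤ (Fintype.card (Config G n) : ℝ) := by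
      rw [div_le_iff₀ hn0]
      linarith
    have h4 := mul_le_mul_of_nonneg_left h3
      (by positivity : 0 ≤ (1 + 8 * Q ^ 2) / √β)
    refine le_of_mul_le_mul_left ?_ hcard
    rw [mul_sub, mul_div_cancel₀ _ hcard.ne']
    refine h1.trans ?_
    linarith
  have hE := exitBound_le hδ0 (by omega) (by linarith : (t : ℝ) ≤ 2 * (β * n)) c x
  rw [← hQdef] at hE
  have hS : 0 ≤ sqDev c x / n := div_nonneg (sqDev_nonneg c x) hn0.le
  have hE2 : Real.exp (16 * β) * (Q * (sqDev c x / n) + 12 * β) / (δ ^ 2 * n) ≤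
      1 / √β * (1 + sqDev c x / n) := by
    have h1 : Q * (sqDev c x / n) + 12 * β ≤ (Q + 12 * β) * (1 + sqDev c x / n) := by
      have : 0 ≤ 12 * β * (sqDev c x / n) := by positivity
      linarith
    calc Real.exp (16 * β) * (Q * (sqDev c x / n) + 12 * β) / (δ ^ 2 * n)
        ≤ Real.exp (16 * β) * ((Q + 12 * β) * (1 + sqDev c x / n)) / (δ ^ 2 * n) := by gcongr
      _ = (Real.exp (16 * β) * (Q + 12 * β) / δ ^ 2 * √β / n) * (1 / √β * (1 + sqDev c x / n)) := by
        field_simp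
      _ ≤ 1 * (1 / √β * (1 + sqDev c x / n)) := by
        gcongr
        rwa [div_le_one hn0]
      _ = _ := one_mul _
  have hfin : (1 + 8 * Q ^ 2) / √β * (2 * Q ^ 2 + sqDev c x / n + 1) ≤
      (1 + 8 * Q ^ 2) / √β * ((2 * Q ^ 2 + 1) * (1 + sqDev c x / n)) := by
    gcongr
    have : 0 ≤ 2 * Q ^ 2 * (sqDev c x / n) := by positivity
    linarith
  have hconst : smoothConst G / √β * (1 + sqDev c x / n) =
      (1 + 8 * Q ^ 2) / √β * ((2 * Q ^ 2 + 1) * (1 + sqDev c x / n)) +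
        1 / √β * (1 + sqDev c x / n) := by
    unfold smoothConst
    ring
  rw [hconst]
  linarith

end Smoothing

end PR

namespace PR

section BurnIn

set_option linter.unusedSectionVars false

variable {G : Type} [Group G] [Fintype G] {n : ℕ} {K : Type} [Fintype K]

/-- The per-step decay rate of the threshold for the deviation of the counts. -/
def decay (n : ℕ) : ℝ := 1 - 1 / (8 * (n : ℝ))

/-- A decaying threshold for the squared deviation of the counts. -/
def threshold (δ : ℝ) (n t : ℕ) : ℝ := (δ * n * decay n ^ t) ^ 2

/-- The squared excess of the squared deviation of the counts over the threshold. -/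
def excess (δ : ℝ) (n t : ℕ) (x : Config G n) : ℝ :=
  (max (unitSqDev x - threshold δ n t) 0) ^ 2

lemma decay_nonneg (hn : 1 ≤ n) : 0 ≤ decay n := by
  have hn' : (1 : ℝ) ≤ n := by exact_mod_cast hn
  unfold decay
  rw [sub_nonneg, div_le_one (by positivity)]
  linarith

lemma decay_le_one (n : ℕ) : decay n ≤ 1 := by
  unfold decay
  have : 0 ≤ 1 / (8 * (n : ℝ)) := by positivity
  linarith

lemma threshold_antitone (hn : 1 ≤ n) {δ : ℝ} (hδ : 0 ≤ δ) {s t : ℕ} (hst : s ≤ t) :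
    threshold δ n t ≤ threshold δ n s := by
  unfold threshold
  have h0 := decay_nonneg hn
  have h1 := pow_le_pow_of_le_one h0 (decay_le_one n) hst
  gcongr

lemma threshold_le (hn : 1 ≤ n) {δ : ℝ} (hδ : 0 ≤ δ) (hδ1 : δ ≤ 1 / 5) (t : ℕ) :
    threshold δ n t ≤ (n : ℝ) ^ 2 / 25 := by
  refine (threshold_antitone hn hδ (Nat.zero_le t)).trans ?_
  unfold threshold
  rw [pow_zero, mul_one, mul_pow]
  have : δ ^ 2 ≤ 1 / 25 := by nlinarith
  nlinarith [sq_nonneg (n : ℝ)]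

lemma stepOp_mono_of_update (hn : 2 ≤ n) {f g : Config G n → ℝ} {x : Config G n}
    (h : ∀ i v, f (Function.update x i v) ≤ g (Function.update x i v)) :
    stepOp f x ≤ stepOp g x := by
  rw [stepOp_eq_wt, stepOp_eq_wt]
  gcongr with i _ v _
  · exact wt_nonneg hn x i v
  · exact h i v

lemma stepOp_sqDev_le_of_unitSqDev_le (hn : 5 ≤ n) {δ : ℝ}
    (hδQ : 25 * (δ ^ 2 * Fintype.card G) ≤ 1) (c : Fin n → K) {t : ℕ} {x : Config G n}
    (hx : unitSqDev x ≤ 4 * threshold δ n t) :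
    stepOp (sqDev c) x ≤ sqDev c x * (1 - 2 / n + decay n ^ t / n) + 6 := by
  have hn' : (5 : ℝ) ≤ n := by exact_mod_cast hn
  have hn0 : 0 < (n : ℝ) := by linarith
  have hn1 : 0 < (n : ℝ) - 1 := by linarith
  have hr := pow_nonneg (decay_nonneg (by omega : 1 ≤ n)) t
  refine (stepOp_sqDev_le (by omega) c x).trans ?_
  have h1 : absDev x ≤ 2 / 5 * (n * decay n ^ t) := by
    refine (le_abs_self _).trans (abs_le_of_sq_le_sq ?_ (by positivity))
    refine (absDev_sq_le x).trans ?_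
    have h2 := mul_le_mul_of_nonneg_left hx (Nat.cast_nonneg (α := ℝ) (Fintype.card G))
    have h3 := mul_le_mul_of_nonneg_right hδQ (sq_nonneg (n * decay n ^ t))
    unfold threshold at h2
    unfold unitSqDev at h2
    nlinarith
  have h2 : 2 * (absDev x / n) / ((n : ℝ) - 1) ≤ decay n ^ t / n := by
    have h3 : absDev x / n ≤ 2 / 5 * decay n ^ t := by
      rw [div_le_iff₀ hn0]
      linarith
    rw [div_le_div_iff₀ hn1 hn0]
    nlinarith
  have := mul_le_mul_of_nonneg_left h2 (sqDev_nonneg c x)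
  linarith

lemma stepOp_excess_le (hn : 5 ≤ n) {δ : ℝ} (hδ : 0 ≤ δ)
    (hδQ : 25 * (δ ^ 2 * Fintype.card G) ≤ 1) {t : ℕ} {x : Config G n}
    (hx : unitSqDev x ≤ 4 * threshold δ n t) :
    stepOp (excess δ n (t + 1)) x ≤ excess δ n t x + 40 * (n : ℝ) ^ 2 := by
  have hn' : (5 : ℝ) ≤ n := by exact_mod_cast hn
  have hn0 : 0 < (n : ℝ) := by linarith
  have hQ := one_le_card (G := G)
  have hδ1 : δ ≤ 1 / 5 := by
    refine (le_abs_self _).trans (abs_le_of_sq_le_sq ?_ (by norm_num))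
    nlinarith [sq_nonneg δ]
  have hr := pow_nonneg (decay_nonneg (by omega : 1 ≤ n)) t
  have hr1 := pow_le_one₀ (decay_nonneg (by omega : 1 ≤ n)) (decay_le_one n) (n := t)
  have hG := threshold_le (by omega : 1 ≤ n) hδ hδ1 t
  have hG0 : 0 ≤ threshold δ n t := sq_nonneg _
  have hGmono := threshold_antitone (by omega : 1 ≤ n) hδ (Nat.le_succ t)
  have hGdiff : threshold δ n t - threshold δ n (t + 1) ≤ threshold δ n t / (4 * n) := by
    have h1 : threshold δ n (t + 1) = threshold δ n t * decay n ^ 2 := by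
      unfold threshold
      ring
    have h2 : 1 - decay n ^ 2 ≤ 1 / (4 * n) := by
      have : 1 / (4 * n) - (1 - decay n ^ 2) = (1 / (8 * (n : ℝ))) ^ 2 := by
        unfold decay
        field_simp
        ring
      nlinarith [sq_nonneg (1 / (8 * (n : ℝ)))]
    have := mul_le_mul_of_nonneg_left h2 hG0
    rw [h1]
    rw [mul_one_div] at this
    linarith
  have hdrift := stepOp_sqDev_le_of_unitSqDev_le hn hδQ (fun _ : Fin n => ()) hx
  set z := max (unitSqDev x - threshold δ n t) 0 with hz
  have hz0 : 0 ≤ z := le_max_right _ _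
  have hzx : unitSqDev x - threshold δ n t ≤ z := le_max_left _ _
  set e := threshold δ n t - threshold δ n (t + 1) with he
  have he2 : e ≤ n := by
    refine hGdiff.trans ?_
    rw [div_le_iff₀ (by positivity)]
    nlinarith
  have hstep : stepOp (excess δ n (t + 1)) x ≤ stepOp (fun y => z * 2 * unitSqDev y +
      (z ^ 2 + z * 2 * (e - unitSqDev x) + 36 * (n : ℝ) ^ 2)) x := by
    refine stepOp_mono_of_update (by omega) fun i v => ?_
    have hΔ := abs_le.1 (abs_sqDev_update_sub_le (fun _ : Fin n => ()) x i v)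
    change -(4 * (n : ℝ) + 2) ≤ unitSqDev (Function.update x i v) - unitSqDev x ∧
      unitSqDev (Function.update x i v) - unitSqDev x ≤ 4 * n + 2 at hΔ
    set Δ := unitSqDev (Function.update x i v) - unitSqDev x + e with hΔdef
    have h1 : Δ ^ 2 ≤ 36 * (n : ℝ) ^ 2 := by
      have he0 : 0 ≤ e := by linarith
      have : |Δ| ≤ 6 * n := by
        rw [abs_le]
        constructor <;> linarith
      calc Δ ^ 2 = |Δ| ^ 2 := (sq_abs Δ).symm
        _ ≤ (6 * n) ^ 2 := by gcongr
        _ = _ := by ring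
    have h2 : excess δ n (t + 1) (Function.update x i v) ≤ (z + Δ) ^ 2 := by
      unfold excess
      rcases le_total (unitSqDev (Function.update x i v) - threshold δ n (t + 1)) 0 with h | h
      · rw [max_eq_right h]
        nlinarith [sq_nonneg (z + Δ)]
      · rw [max_eq_left h]
        gcongr
        linarith
    refine h2.trans ?_
    have h3 : (z + Δ) ^ 2 = z ^ 2 + z * 2 * Δ + Δ ^ 2 := by ring
    rw [h3, hΔdef]
    rw [hΔdef] at h1
    linarith
  refine hstep.trans ?_
  rw [stepOp_add, stepOp_mul_left, stepOp_const (by omega)]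
  change stepOp unitSqDev x ≤ unitSqDev x * _ + 6 at hdrift
  have hY0 := unitSqDev_nonneg x
  have h4 : z * (stepOp unitSqDev x + (e - unitSqDev x)) ≤ z * 6 := by
    rcases eq_or_lt_of_le hz0 with h | h
    · rw [← h]
      simp
    · refine mul_le_mul_of_nonneg_left ?_ hz0
      have h5 : threshold δ n t ≤ unitSqDev x := by
        by_contra hcon
        rw [hz, max_eq_right (by linarith)] at h
        exact lt_irrefl _ h
      have h6 : unitSqDev x * (1 - 2 / n + decay n ^ t / n) ≤ unitSqDev x * (1 - 1 / n) := by
        refine mul_le_mul_of_nonneg_left ?_ hY0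
        have : decay n ^ t / n ≤ 1 / n := by gcongr
        have h7 : 2 / (n : ℝ) = 1 / n + 1 / n := by ring
        linarith
      have h7 : threshold δ n t / (4 * n) ≤ unitSqDev x * (1 / n) := by
        rw [mul_one_div, div_le_div_iff₀ (by positivity) hn0]
        nlinarith
      linarith
  have h8 : z ≤ 3 * (n : ℝ) ^ 2 / 25 := by
    refine max_le (by linarith) (by positivity)
  unfold excess
  rw [← hz]
  nlinarith [sq_nonneg (n : ℝ)]

lemma iterate_stepOp_le_of_le (hn : 5 ≤ n) {δ : ℝ} (hδ : 0 ≤ δ)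
    (hδQ : 25 * (δ ^ 2 * Fintype.card G) ≤ 1) (c : Fin n → K) {f : Config G n → ℝ}
    {a b w : ℝ} {T : ℕ} (ha : 0 ≤ a) (hb : 0 ≤ b) (hw : 0 ≤ w)
    (hf1 : ∀ x, f x ≤ 1) (hf : ∀ x, f x ≤ a + b * sqDev c x)
    (hwT : 1 ≤ w * (9 * threshold δ n T ^ 2)) (j : ℕ) : ∀ t, t + j ≤ T → ∀ x,
      (stepOp^[j] f) x ≤ a + b * ((1 - 2 / (n : ℝ)) ^ j * Real.exp (16 * decay n ^ t) * sqDev c x +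
        3 * n * Real.exp 16 * (1 - (1 - 2 / (n : ℝ)) ^ j)) + w * excess δ n t x +
        w * (40 * (n : ℝ) ^ 2) * j := by
  have hn' : (5 : ℝ) ≤ n := by exact_mod_cast hn
  have hn0 : 0 < (n : ℝ) := by linarith
  have hm0 : 1 / 2 ≤ 1 - 2 / (n : ℝ) := by
    have : 2 / (n : ℝ) ≤ 1 / 2 := by
      rw [div_le_div_iff₀ hn0 (by norm_num)]
      linarith
    linarith
  have hm1 : 1 - 2 / (n : ℝ) ≤ 1 := by
    have : 0 ≤ 2 / (n : ℝ) := by positivity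
    linarith
  set m := 1 - 2 / (n : ℝ) with hm
  have hmj : ∀ j, m ^ j ≤ 1 := fun j => pow_le_one₀ (by linarith) hm1
  have hmj0 : ∀ j, 0 ≤ m ^ j := fun j => pow_nonneg (by linarith) j
  have hr0 := decay_nonneg (by omega : 1 ≤ n)
  induction j with
  | zero =>
    intro t _ x
    have h1 : 0 ≤ w * excess δ n t x := mul_nonneg hw (sq_nonneg _)
    have h2 : (1 : ℝ) ≤ Real.exp (16 * decay n ^ t) := Real.one_le_exp (by positivity)
    have h3 := sqDev_nonneg c x
    have h4 : b * sqDev c x ≤ b * (Real.exp (16 * decay n ^ t) * sqDev c x) :=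
      mul_le_mul_of_nonneg_left (le_mul_of_one_le_left h3 h2) hb
    have := hf x
    simp only [Function.iterate_zero, id_eq, pow_zero, Nat.cast_zero]
    linarith
  | succ j ih =>
    intro t ht x
    have hS := sqDev_nonneg c x
    by_cases hx : unitSqDev x ≤ 4 * threshold δ n t
    · rw [Function.iterate_succ_apply']
      have h1 := stepOp_mono (ih (t + 1) (by omega)) x
      refine h1.trans ?_
      have hrw : (fun x : Config G n => a + b * (m ^ j * Real.exp (16 * decay n ^ (t + 1)) *
          sqDev c x + 3 * n * Real.exp 16 * (1 - m ^ j)) + w * excess δ n (t + 1) x +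
          w * (40 * (n : ℝ) ^ 2) * j) = fun x => (b * (m ^ j * Real.exp (16 * decay n ^ (t + 1))) *
          sqDev c x + w * excess δ n (t + 1) x) +
          (a + b * (3 * n * Real.exp 16 * (1 - m ^ j)) + w * (40 * (n : ℝ) ^ 2) * j) := by
        funext x
        ring
      have h2 := stepOp_sqDev_le_of_unitSqDev_le hn hδQ c hx
      have h3 := mul_le_mul_of_nonneg_left (stepOp_excess_le hn hδ hδQ hx) hw
      have h4 : (1 - 2 / (n : ℝ) + decay n ^ t / n) ≤ m * Real.exp (2 * decay n ^ t / n) := by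
        have h5 := Real.add_one_le_exp (2 * decay n ^ t / n)
        have h6 : 0 ≤ decay n ^ t / n := by positivity
        have h7 : 2 * decay n ^ t / n = 2 * (decay n ^ t / n) := by ring
        rw [← hm]
        nlinarith
      have h5 : Real.exp (16 * decay n ^ (t + 1)) * Real.exp (2 * decay n ^ t / n) =
          Real.exp (16 * decay n ^ t) := by
        rw [← Real.exp_add, pow_succ]
        congr 1
        unfold decay
        field_simp
        ring
      have h6 : Real.exp (16 * decay n ^ (t + 1)) ≤ Real.exp 16 := by
        rw [Real.exp_le_exp]
        have := pow_le_one₀ hr0 (decay_le_one n) (n := t + 1)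
        linarith
      have h7 : Real.exp (16 * decay n ^ (t + 1)) * stepOp (sqDev c) x ≤
          m * Real.exp (16 * decay n ^ t) * sqDev c x + 6 * Real.exp 16 := by
        calc Real.exp (16 * decay n ^ (t + 1)) * stepOp (sqDev c) x
            ≤ Real.exp (16 * decay n ^ (t + 1)) *
              (sqDev c x * (m * Real.exp (2 * decay n ^ t / n)) + 6) := by
              gcongr
              refine h2.trans ?_
              gcongr
          _ = m * (Real.exp (16 * decay n ^ (t + 1)) * Real.exp (2 * decay n ^ t / n)) *
              sqDev c x + 6 * Real.exp (16 * decay n ^ (t + 1)) := by ring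
          _ ≤ _ := by
              rw [h5]
              gcongr
      have h8 := mul_le_mul_of_nonneg_left h7 (mul_nonneg hb (hmj0 j))
      have h9 : 3 * n * Real.exp 16 * (1 - m ^ (j + 1)) =
          3 * n * Real.exp 16 * (1 - m ^ j) + m ^ j * (6 * Real.exp 16) := by
        rw [pow_succ, hm]
        field_simp
        ring
      rw [hrw, stepOp_add, stepOp_add, stepOp_mul_left, stepOp_mul_left, stepOp_const (by omega),
        h9, pow_succ m j]
      push_cast
      linarith
    · have h1 := iterate_stepOp_le_one (by omega) hf1 (j + 1) x
      rw [not_le] at hx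
      have hG0 : 0 ≤ threshold δ n T := sq_nonneg _
      have hGt := threshold_antitone (by omega : 1 ≤ n) hδ (by omega : t ≤ T)
      have h2 : 9 * threshold δ n T ^ 2 ≤ excess δ n t x := by
        unfold excess
        rw [max_eq_left (by linarith)]
        have : 3 * threshold δ n T ≤ unitSqDev x - threshold δ n t := by linarith
        calc 9 * threshold δ n T ^ 2 = (3 * threshold δ n T) ^ 2 := by ring
          _ ≤ _ := by gcongr
      have h3 := mul_le_mul_of_nonneg_left h2 hw
      have h4 : 0 ≤ 1 - m ^ (j + 1) := sub_nonneg.2 (hmj _)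
      have h5 : 0 ≤ b * (m ^ (j + 1) * Real.exp (16 * decay n ^ t) * sqDev c x +
          3 * n * Real.exp 16 * (1 - m ^ (j + 1))) := by
        have := hmj0 (j + 1)
        positivity
      have h6 : 0 ≤ w * (40 * (n : ℝ) ^ 2) * ((j + 1 : ℕ) : ℝ) := by positivity
      linarith

end BurnIn

end PR

namespace PR

section BurnInTime

set_option linter.unusedSectionVars false

variable {G : Type} [Group G] [Fintype G] {n : ℕ} {K : Type} [Fintype K]

lemma sqDev_le (c : Fin n → K) (x : Config G n) :
    sqDev c x ≤ Fintype.card K * Fintype.card G * (n : ℝ) ^ 2 := by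
  have h : ∀ k b, dev c x k b ^ 2 ≤ (n : ℝ) ^ 2 := fun k b => by
    rw [← sq_abs]
    gcongr
    exact abs_dev_le c x k b
  refine (Finset.sum_le_sum fun k _ => Finset.sum_le_sum fun b _ => h k b).trans_eq ?_
  simp [mul_assoc]

lemma unitSqDev_le_of_mem_SAst (hn : 1 ≤ n) {δ : ℝ} {σ : Config G n} (hσ : σ ∈ SAst G n δ) :
    unitSqDev σ ≤ (δ * n) ^ 2 := by
  have hn0 : (0 : ℝ) < n := by exact_mod_cast hn
  have h1 := Real.sqrt_le_iff.1 hσ.2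
  have h2 : unitSqDev σ = n ^ 2 * ∑ a : G, ((nCount G σ a : ℝ) / n -
      1 / (Fintype.card G : ℝ)) ^ 2 := by
    unfold unitSqDev sqDev
    rw [Fintype.sum_unique, Finset.mul_sum]
    refine Finset.sum_congr rfl fun a _ => ?_
    rw [show (default : Unit) = () from rfl, dev_unit_eq]
    field_simp
  rw [h2, mul_pow, mul_comm]
  gcongr
  exact h1.2

lemma exp_neg_le_decay (hn : 1 ≤ n) : Real.exp (-(1 / (4 * (n : ℝ)))) ≤ decay n := by
  have hn' : (1 : ℝ) ≤ n := by exact_mod_cast hn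
  have h1 := Real.add_one_le_exp (1 / (4 * (n : ℝ)))
  rw [Real.exp_neg, inv_le_comm₀ (Real.exp_pos _) ?_]
  · refine le_trans ?_ h1
    unfold decay
    rw [inv_le_iff_one_le_mul₀ ?_]
    · field_simp
      nlinarith
    · rw [sub_pos, div_lt_one (by positivity)]
      linarith
  · unfold decay
    rw [sub_pos, div_lt_one (by positivity)]
    linarith

lemma le_threshold_sq (hn : 1 ≤ n) (δ : ℝ) {T : ℕ} (hT : (T : ℝ) ≤ 1 / 2 * n * Real.log n + 1) :
    δ ^ 4 * n ^ 4 * (Real.exp (-1) / √n) ≤ threshold δ n T ^ 2 := by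
  have hn' : (1 : ℝ) ≤ n := by exact_mod_cast hn
  have hn0 : (0 : ℝ) < n := by linarith
  have h1 : threshold δ n T ^ 2 = δ ^ 4 * n ^ 4 * (decay n ^ (4 * T)) := by
    unfold threshold
    rw [pow_mul]
    ring
  have h2 : Real.exp (-1) / √n ≤ decay n ^ (4 * T) := by
    have h3 : √(n : ℝ) = Real.exp (Real.log n / 2) := by
      rw [Real.exp_half, Real.exp_log hn0]
    calc Real.exp (-1) / √n = Real.exp (-1 - Real.log n / 2) := by rw [h3, Real.exp_sub]
      _ ≤ Real.exp ((4 * T : ℕ) * (-(1 / (4 * (n : ℝ))))) := by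
        rw [Real.exp_le_exp]
        have h4 : ((4 * T : ℕ) : ℝ) * (-(1 / (4 * (n : ℝ)))) = -(T / n) := by
          push_cast
          field_simp
        have h5 : (T : ℝ) / n ≤ Real.log n / 2 + 1 := by
          rw [div_le_iff₀ hn0]
          linarith
        linarith
      _ = Real.exp (-(1 / (4 * (n : ℝ)))) ^ (4 * T) := Real.exp_nat_mul _ _
      _ ≤ _ := by
        gcongr
        exact exp_neg_le_decay hn
  rw [h1]
  gcongr

lemma eventually_log_div_sqrt_le (C : ℝ) {ε : ℝ} (hε : 0 < ε) :
    ∀ᶠ n : ℕ in atTop, C * (Real.log n / √n) ≤ ε := by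
  have h1 : Tendsto (fun x : ℝ => Real.log x / x ^ (1 / 2 : ℝ)) atTop (nhds 0) :=
    (isLittleO_log_rpow_atTop (by norm_num : (0 : ℝ) < 1 / 2)).tendsto_div_nhds_zero
  have h2 := (h1.comp tendsto_natCast_atTop_atTop).const_mul C
  rw [mul_zero] at h2
  filter_upwards [h2.eventually_le_const hε] with n hn
  simpa [Real.sqrt_eq_rpow] using hn

lemma iterate_stepOp_burnIn_le (G : Type) [Group G] [Fintype G] {ε : ℝ} (hε : 0 < ε) :
    ∀ᶠ n : ℕ in atTop, ∀ c ∈ SAst G n (1 / (5 * (Fintype.card G : ℝ) ^ 3)),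
      ∀ f : Config G n → ℝ, (∀ x, f x ≤ 1) → ∀ a b : ℝ, 0 ≤ a → 0 ≤ b →
      (∀ x, f x ≤ a + b * (sqDev c x / n)) →
      (stepOp^[⌈(1 / 2 : ℝ) * n * Real.log n⌉₊] f) c ≤
        a + b * (Real.exp 16 * ((Fintype.card G : ℝ) ^ 2 + 3)) + ε := by
  have hQ := one_le_card (G := G)
  have hQ0 : 0 < (Fintype.card G : ℝ) := by linarith
  set Q := (Fintype.card G : ℝ) with hQdef
  obtain ⟨δ, hδ⟩ : ∃ δ, δ = 1 / (5 * Q ^ 3) := ⟨_, rfl⟩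
  have hδ0 : 0 < δ := by
    rw [hδ]
    positivity
  have hδQ : 25 * (δ ^ 2 * Q) ≤ 1 := by
    have : 25 * (δ ^ 2 * Q) = 1 / Q ^ 5 := by
      rw [hδ]
      field_simp
      norm_num
    rw [this, div_le_one (by positivity)]
    exact one_le_pow₀ hQ
  rw [← hδ]
  have hev : ∀ A : ℝ, ∀ᶠ n : ℕ in atTop, A ≤ n := fun A =>
    tendsto_natCast_atTop_atTop.eventually_ge_atTop A
  filter_upwards [hev 5, hev (Real.exp 1),
    eventually_log_div_sqrt_le (40 / (9 * δ ^ 4 * Real.exp (-1))) hε] with n hn5 hne hlog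
  intro c hc f hf1 a b ha hb hf
  have hn : 5 ≤ n := by exact_mod_cast hn5
  have hn0 : 0 < (n : ℝ) := by linarith
  have hlog1 : 1 ≤ Real.log n := by
    rw [Real.le_log_iff_exp_le hn0]
    exact hne
  have hT1 : (1 / 2 : ℝ) * n * Real.log n ≤ (⌈(1 / 2 : ℝ) * n * Real.log n⌉₊ : ℝ) := Nat.le_ceil _
  have hT2 : (⌈(1 / 2 : ℝ) * n * Real.log n⌉₊ : ℝ) < (1 / 2 : ℝ) * n * Real.log n + 1 :=
    Nat.ceil_lt_add_one (by positivity)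
  generalize ⌈(1 / 2 : ℝ) * n * Real.log n⌉₊ = T at hT1 hT2 ⊢
  have hT3 : (T : ℝ) ≤ n * Real.log n := by nlinarith
  have hG := le_threshold_sq (by omega : 1 ≤ n) δ hT2.le
  have hGpos : 0 < δ ^ 4 * n ^ 4 * (Real.exp (-1) / √n) := by positivity
  have hmain := iterate_stepOp_le_of_le hn hδ0.le hδQ c (a := a) (b := b / n)
    (w := 1 / (9 * threshold δ n T ^ 2)) (T := T) ha (by positivity) (by positivity) hf1
    (fun x => by
      have := hf x
      rwa [mul_div_assoc', mul_comm b, mul_div_assoc, mul_comm] at this)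
    (by rw [one_div_mul_cancel (by linarith)]) T 0 (by omega) c
  have hexc : excess δ n 0 c = 0 := by
    unfold excess threshold
    have := unitSqDev_le_of_mem_SAst (by omega) hc
    rw [pow_zero, mul_one, max_eq_right (by linarith)]
    norm_num
  rw [hexc, mul_zero, add_zero, pow_zero, mul_one] at hmain
  refine hmain.trans ?_
  have hm0 : 0 ≤ 1 - 2 / (n : ℝ) := by
    rw [sub_nonneg, div_le_one hn0]
    linarith
  have hmT : (1 - 2 / (n : ℝ)) ^ T ≤ 1 / n := by
    calc (1 - 2 / (n : ℝ)) ^ T ≤ Real.exp (-(2 / n)) ^ T := by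
          gcongr
          have := Real.add_one_le_exp (-(2 / (n : ℝ)))
          linarith
      _ = Real.exp (T * (-(2 / n))) := (Real.exp_nat_mul _ _).symm
      _ ≤ Real.exp (-Real.log n) := by
          rw [Real.exp_le_exp]
          have : (T : ℝ) * (-(2 / n)) = -(2 * T / n) := by ring
          rw [this, neg_le_neg_iff, le_div_iff₀ hn0]
          linarith
      _ = 1 / n := by rw [Real.exp_neg, Real.exp_log hn0, one_div]
  have hmT0 := pow_nonneg hm0 T
  have h1 : b / n * ((1 - 2 / (n : ℝ)) ^ T * Real.exp 16 * sqDev c c +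
      3 * n * Real.exp 16 * (1 - (1 - 2 / (n : ℝ)) ^ T)) ≤ b * (Real.exp 16 * (Q ^ 2 + 3)) := by
    calc b / n * ((1 - 2 / (n : ℝ)) ^ T * Real.exp 16 * sqDev c c +
        3 * n * Real.exp 16 * (1 - (1 - 2 / (n : ℝ)) ^ T))
        ≤ b / n * (1 / n * Real.exp 16 * (Q * Q * n ^ 2) + 3 * n * Real.exp 16 * 1) := by
          have := sqDev_le c c
          have := sqDev_nonneg c c
          gcongr
          linarith
      _ = _ := by
          field_simp
  have h2 : 1 / (9 * threshold δ n T ^ 2) * (40 * (n : ℝ) ^ 2) * T ≤ ε := by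
    refine le_trans ?_ hlog
    calc 1 / (9 * threshold δ n T ^ 2) * (40 * (n : ℝ) ^ 2) * T
        ≤ 1 / (9 * (δ ^ 4 * n ^ 4 * (Real.exp (-1) / √n))) * (40 * (n : ℝ) ^ 2) *
          (n * Real.log n) := by gcongr
      _ = _ := by
        have hs := Real.sqrt_pos.2 hn0
        have hss := Real.sq_sqrt hn0.le
        have he := Real.exp_pos (-1)
        rw [← sub_eq_zero]
        field_simp
        rw [hss]
        ring
  linarith

end BurnInTime

end PR

namespace PR

section TotalVariation

set_option linter.unusedSectionVars false

variable {G : Type} [Group G] [Fintype G] {n : ℕ}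

/-- The average of the indicator of `A` over the relabellings of the sites that fix `c`. -/
def symmIndicator (c : Config G n) (A : Finset (Config G n)) (x : Config G n) : ℝ :=
  (∑ ρ : {ρ : Equiv.Perm (Fin n) // ∀ i, c (ρ i) = c i}, if x ∘ ρ.1 ∈ A then 1 else 0) /
    (Fintype.card {ρ : Equiv.Perm (Fin n) // ∀ i, c (ρ i) = c i} : ℝ)

lemma card_stabilizer_pos (c : Config G n) :
    (0 : ℝ) < (Fintype.card {ρ : Equiv.Perm (Fin n) // ∀ i, c (ρ i) = c i} : ℝ) := by
  have : Nonempty {ρ : Equiv.Perm (Fin n) // ∀ i, c (ρ i) = c i} := ⟨⟨1, fun _ => rfl⟩⟩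
  exact_mod_cast Fintype.card_pos

lemma symmIndicator_nonneg (c : Config G n) (A : Finset (Config G n)) (x : Config G n) :
    0 ≤ symmIndicator c A x := by
  unfold symmIndicator
  refine div_nonneg (Finset.sum_nonneg fun ρ _ => ?_) (card_stabilizer_pos c).le
  split_ifs <;> norm_num

lemma symmIndicator_le_one (c : Config G n) (A : Finset (Config G n)) (x : Config G n) :
    symmIndicator c A x ≤ 1 := by
  unfold symmIndicator
  rw [div_le_one (card_stabilizer_pos c)]
  refine (Finset.sum_le_card_nsmul _ _ 1 fun ρ _ => ?_).trans (by simp)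
  split_ifs <;> norm_num

lemma symmIndicator_comp (c : Config G n) (A : Finset (Config G n)) (τ : Equiv.Perm (Fin n))
    (hτ : ∀ i, c (τ i) = c i) (x : Config G n) :
    symmIndicator c A (x ∘ τ) = symmIndicator c A x := by
  unfold symmIndicator
  congr 1
  have hτ' : ∀ i, c (τ⁻¹ i) = c i := fun i => by
    rw [← hτ (τ⁻¹ i), ← Equiv.Perm.mul_apply, mul_inv_cancel, Equiv.Perm.one_apply]
  let e : {ρ : Equiv.Perm (Fin n) // ∀ i, c (ρ i) = c i} ≃
      {ρ : Equiv.Perm (Fin n) // ∀ i, c (ρ i) = c i} :=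
    { toFun := fun ρ => ⟨τ * ρ.1, fun i => by rw [Equiv.Perm.mul_apply, hτ, ρ.2]⟩
      invFun := fun ρ => ⟨τ⁻¹ * ρ.1, fun i => by rw [Equiv.Perm.mul_apply, hτ', ρ.2]⟩
      left_inv := fun ρ => by simp
      right_inv := fun ρ => by simp }
  exact Equiv.sum_comp e (fun ρ => if x ∘ ρ.1 ∈ A then (1 : ℝ) else 0)

lemma sum_symmIndicator (c : Config G n) (A : Finset (Config G n)) :
    ∑ x, symmIndicator c A x = A.card := by
  have h : ∀ ρ : Equiv.Perm (Fin n),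
      ∑ x : Config G n, (if x ∘ ρ ∈ A then (1 : ℝ) else 0) = A.card := by
    intro ρ
    refine (Equiv.sum_comp (Equiv.arrowCongr ρ.symm (Equiv.refl G))
      (fun x : Config G n => if x ∈ A then (1 : ℝ) else 0)).trans ?_
    simp
  unfold symmIndicator
  rw [← Finset.sum_div, Finset.sum_comm, Finset.sum_congr rfl fun ρ _ => h ρ.1]
  rw [Finset.sum_const, Finset.card_univ, nsmul_eq_mul,
    mul_div_cancel_left₀ _ (card_stabilizer_pos c).ne']

lemma sum_law_eq_iterate (c : Config G n) (A : Finset (Config G n)) (t : ℕ) :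
    ∑ y ∈ A, law G c t y = (stepOp^[t] fun y => if y ∈ A then 1 else 0) c := by
  rw [← sum_law_mul]
  simp

lemma iterate_stepOp_symmIndicator (c : Config G n) (A : Finset (Config G n)) (t : ℕ) :
    (stepOp^[t] (symmIndicator c A)) c = ∑ y ∈ A, law G c t y := by
  rw [← sum_law_mul]
  simp only [symmIndicator, mul_div_assoc']
  rw [← Finset.sum_div]
  simp only [Finset.mul_sum]
  rw [Finset.sum_comm, Finset.sum_congr rfl (g := fun _ => ∑ y ∈ A, law G c t y)]
  · rw [Finset.sum_const, Finset.card_univ, nsmul_eq_mul,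
      mul_div_cancel_left₀ _ (card_stabilizer_pos c).ne']
  · intro ρ _
    rw [sum_law_mul c t (fun y => if y ∘ ρ.1 ∈ A then (1 : ℝ) else 0), sum_law_eq_iterate,
      ← iterate_stepOp_comp_perm ρ.1 t (fun y => if y ∈ A then (1 : ℝ) else 0) c]
    exact congrArg _ (funext ρ.2)

lemma sum_law (hn : 2 ≤ n) (c : Config G n) (t : ℕ) : ∑ y, law G c t y = 1 := by
  have h := sum_law_mul c t (fun _ => 1)
  simp only [mul_one] at h
  have h1 : stepOp (fun _ : Config G n => (1 : ℝ)) = fun _ => 1 :=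
    funext fun x => stepOp_const hn 1 x
  rw [h, Function.iterate_fixed h1]

lemma sum_law_le_one (hn : 2 ≤ n) (c : Config G n) (A : Finset (Config G n)) (t : ℕ) :
    ∑ y ∈ A, law G c t y ≤ 1 := by
  rw [sum_law_eq_iterate]
  refine iterate_stepOp_le_one hn (fun x => ?_) t c
  split_ifs <;> norm_num

lemma sum_law_sub_le (G : Type) [Group G] [Fintype G] {β : ℝ} (hβ : 0 < β) :
    ∀ᶠ n : ℕ in atTop, ∀ c ∈ SAst G n (1 / (5 * (Fintype.card G : ℝ) ^ 3)),
      ∀ A : Finset (Config G n),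
        ∑ y ∈ A, law G c (⌈(1 / 2 : ℝ) * n * Real.log n⌉₊ + ⌈β * n⌉₊) y ≤
          A.card / (Fintype.card (Config G n) : ℝ) +
            (smoothConst G * (1 + Real.exp 16 * ((Fintype.card G : ℝ) ^ 2 + 3)) + 1) / √β := by
  have hs : 0 < √β := Real.sqrt_pos.2 hβ
  have hsm : 0 ≤ smoothConst G := by unfold smoothConst; positivity
  filter_upwards [iterate_stepOp_sub_average_le G hβ,
    iterate_stepOp_burnIn_le G (one_div_pos.2 hs), eventually_ge_atTop 2] with n h1 h2 hn c hc A
  rw [← iterate_stepOp_symmIndicator, Function.iterate_add_apply]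
  have h3 := h1 c hc (symmIndicator c A) (symmIndicator_nonneg c A) (symmIndicator_le_one c A)
    (symmIndicator_comp c A)
  rw [sum_symmIndicator] at h3
  refine (h2 c hc _ (iterate_stepOp_le_one hn (symmIndicator_le_one c A) _)
    (A.card / (Fintype.card (Config G n) : ℝ) + smoothConst G / √β) (smoothConst G / √β)
    (by positivity) (by positivity) fun x => ?_).trans_eq ?_
  · have := h3 x
    linarith
  · ring

lemma card_not_mem_gens_le (hn : 1 ≤ n) :
    ((Finset.univ.filter fun x : Config G n => x ∉ gens G n).card : ℝ) * n ≤
      (Fintype.card G : ℝ) ^ 2 * Fintype.card (Config G n) := by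
  have hn0 : (0 : ℝ) < n := by exact_mod_cast hn
  have hQ := one_le_card (G := G)
  set Q : ℝ := (Fintype.card G : ℝ)
  have hx : ∀ x ∈ Finset.univ.filter (fun x : Config G n => x ∉ gens G n),
      (n / Q) ^ 2 ≤ sqDev (fun _ => ()) x := by
    intro x hx
    have hx' : x ∉ gens G n := (Finset.mem_filter.1 hx).2
    obtain ⟨g, hg⟩ : ∃ g, ∀ i, x i ≠ g := by
      by_contra! h
      refine hx' ?_
      have : Set.range x = Set.univ := Set.eq_univ_of_forall h
      change Subgroup.closure (Set.range x) = ⊤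
      rw [this, Subgroup.closure_univ]
    have hd := dev_unit_eq x g
    have h0 : nCount G x g = 0 := by simp [nCount, hg]
    rw [h0] at hd
    have : dev (fun _ => ()) x () g ^ 2 = (n / Q) ^ 2 := by
      rw [hd]
      push_cast
      ring
    rw [← this]
    unfold sqDev
    simp only [Finset.univ_unique, Finset.sum_singleton]
    exact Finset.single_le_sum (f := fun b => dev (fun _ => ()) x () b ^ 2)
      (fun _ _ => sq_nonneg _) (Finset.mem_univ g)
  have h1 := Finset.card_nsmul_le_sum _ _ _ hx
  have h2 := Finset.sum_le_sum_of_subset_of_nonneg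
    (Finset.subset_univ (Finset.univ.filter fun x : Config G n => x ∉ gens G n))
    (fun x _ _ => sqDev_nonneg (fun _ => ()) x)
  have h3 := (h1.trans h2).trans (sum_sqDev_le hn (fun _ => ()))
  rw [nsmul_eq_mul, div_pow, mul_div_assoc', div_le_iff₀ (by positivity)] at h3
  refine le_of_mul_le_mul_left ?_ hn0
  linarith

lemma sum_statDist (A : Finset (Config G n)) :
    ∑ x ∈ A, statDist G n x = ((A.filter fun x => x ∈ gens G n).card : ℝ) /
      ((Finset.univ.filter fun x : Config G n => x ∈ gens G n).card : ℝ) := by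
  unfold statDist
  rw [← Finset.sum_filter, Finset.sum_const, nsmul_eq_mul, mul_one_div]

lemma card_div_le_sum_statDist (hn : 1 ≤ n) (A : Finset (Config G n)) (hne : (gens G n).Nonempty) :
    A.card / (Fintype.card (Config G n) : ℝ) ≤
      ∑ x ∈ A, statDist G n x + (Fintype.card G : ℝ) ^ 2 / n := by
  have hn0 : (0 : ℝ) < n := by exact_mod_cast hn
  have hM : (0 : ℝ) < Fintype.card (Config G n) := by exact_mod_cast Fintype.card_pos
  obtain ⟨σ, hσ⟩ := hne
  have hMg : (0 : ℝ) < (Finset.univ.filter fun x : Config G n => x ∈ gens G n).card := by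
    exact_mod_cast Finset.card_pos.2 ⟨σ, by simpa using hσ⟩
  have hle : ((Finset.univ.filter fun x : Config G n => x ∈ gens G n).card : ℝ) ≤
      Fintype.card (Config G n) := by
    exact_mod_cast Finset.card_le_univ _
  have hsplit : (A.card : ℝ) ≤ (A.filter fun x => x ∈ gens G n).card +
      (Finset.univ.filter fun x : Config G n => x ∉ gens G n).card := by
    have h1 := Finset.card_filter_add_card_filter_not (s := A) (fun x => x ∈ gens G n)
    have h2 := Finset.card_le_card
      (Finset.filter_subset_filter (fun x => x ∉ gens G n) (Finset.subset_univ A))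
    exact_mod_cast h1.symm.le.trans (by gcongr)
  have hbad := card_not_mem_gens_le (G := G) hn
  rw [sum_statDist]
  calc _ ≤ ((A.filter fun x => x ∈ gens G n).card +
        (Finset.univ.filter fun x : Config G n => x ∉ gens G n).card : ℝ) /
          Fintype.card (Config G n) := by gcongr
    _ ≤ _ := by
      rw [add_div]
      refine add_le_add (by gcongr) ?_
      rw [div_le_div_iff₀ hM hn0]
      exact hbad

lemma tvDist_le {α : Type} [Fintype α] {p q : α → ℝ} (hp : ∑ a, p a = 1) (hq : ∑ a, q a = 1)
    {B : ℝ} (h : ∀ A : Finset α, ∑ a ∈ A, p a ≤ ∑ a ∈ A, q a + B) : tvDist p q ≤ B := by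
  refine csSup_le ⟨_, ∅, rfl⟩ ?_
  rintro _ ⟨A, rfl⟩
  have h1 := h A
  have h2 := h Aᶜ
  have h3 := Finset.sum_add_sum_compl A p
  have h4 := Finset.sum_add_sum_compl A q
  rw [abs_le]
  constructor <;> linarith

end TotalVariation

end PR

/-- Lemma 2.7: with `T = ⌈(1/2) n log n⌉ + ⌈β n⌉`, there is a constant
`C_G` depending only on `G` such that for every `β > 0`, every `σ_* ∈ S_*(1/(5Q³))` and all
sufficiently large `n`, `‖Pr_{σ_*}(σ_T ∈ ·) − π‖_TV ≤ C_G / β^{1/4}`. -/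
theorem coupling_tv_bound
    (G : Type) [Group G] [Fintype G] :
    ∃ C : ℝ, ∀ β : ℝ, 0 < β →
      ∃ N : ℕ, ∀ n : ℕ, N ≤ n →
        ∀ σast ∈ PR.SAst G n (1 / (5 * (Fintype.card G : ℝ) ^ 3)),
          PR.tvDist (PR.law G σast (⌈(1 / 2 : ℝ) * n * Real.log n⌉₊ + ⌈β * n⌉₊))
              (PR.statDist G n)
            ≤ C / β ^ ((1 : ℝ) / 4) := by
  have hsm : 0 ≤ PR.smoothConst G := by unfold PR.smoothConst; positivity
  set D : ℝ := PR.smoothConst G * (1 + Real.exp 16 * ((Fintype.card G : ℝ) ^ 2 + 3)) with hD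
  have hD0 : 0 ≤ D := by positivity
  refine ⟨D + 2, fun β hβ => ?_⟩
  have hs : 0 < √β := Real.sqrt_pos.2 hβ
  have hlim : ∀ᶠ n : ℕ in atTop, (Fintype.card G : ℝ) ^ 2 / n ≤ 1 / √β :=
    (tendsto_const_div_atTop_nhds_zero_nat ((Fintype.card G : ℝ) ^ 2)).eventually_le_const
      (one_div_pos.2 hs)
  obtain ⟨N, hN⟩ := eventually_atTop.1
    ((PR.sum_law_sub_le G hβ).and (hlim.and (eventually_ge_atTop 2)))
  refine ⟨N, fun n hn σ hσ => ?_⟩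
  obtain ⟨hlaw, hQ, hn2⟩ := hN n hn
  have hne : (PR.gens G n).Nonempty := ⟨σ, hσ.1⟩
  refine PR.tvDist_le (PR.sum_law hn2 σ _) ?_ fun A => ?_
  · rw [PR.sum_statDist, div_self]
    exact_mod_cast (Finset.card_pos.2 ⟨σ, by simpa using hσ.1⟩).ne'
  rcases le_total 1 β with h1 | h1
  · have h2 := hlaw σ hσ A
    have h3 := PR.card_div_le_sum_statDist (by omega) A hne
    have h4 : (D + 2) / √β ≤ (D + 2) / β ^ ((1 : ℝ) / 4) := by
      rw [Real.sqrt_eq_rpow]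
      gcongr
      norm_num
    have h5 : (D + 2) / √β = (D + 1) / √β + 1 / √β := by ring
    linarith
  · have h2 : β ^ ((1 : ℝ) / 4) ≤ 1 := Real.rpow_le_one hβ.le h1 (by norm_num)
    have h3 : 1 ≤ (D + 2) / β ^ ((1 : ℝ) / 4) := by
      rw [le_div_iff₀ (by positivity)]
      linarith
    have h4 : 0 ≤ ∑ x ∈ A, PR.statDist G n x := by
      rw [PR.sum_statDist]
      positivity
    have h5 := PR.sum_law_le_one hn2 σ A (⌈(1 / 2 : ℝ) * n * Real.log n⌉₊ + ⌈β * n⌉₊)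
    linarith
end
end

section
/- Let (z(t))_{t≥0} be a sequence of [0,1]-valued random variables adapted to a filtration (F_t)_{t≥0}, let ε ∈ (0,1), and let φ : ℝ⁺ → (0,1] be a non-decreasing function. Suppose there are random variables M(t), with M(t) being F_t-measurable, such that z(t+1) − z(t) ≤ −ε·φ(t+1)·z(t) + M(t+1) for all t, and for some constant D one has E[M(t+1) | F_t] ≤ D·ε·√ε and |M(t)| ≤ D·ε almost surely. Then for each t and each λ > 0, Pr(z(t) ≥ λ·√ε + e^{−ε·∫₀ᵗ φ(s) ds}·z(0)) ≤ C_{D,φ}·e^{−c_{D,φ}·λ²}, for constants c_{D,φ}, C_{D,φ} > 0 depending only on D and φ. -/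
open MeasureTheory Filter
open scoped BigOperators

theorem exp_le_add_exp_sq (x : ℝ) : Real.exp x ≤ x + Real.exp (x ^ 2) := by
  have h1 := Real.add_one_le_exp (x ^ 2)
  rcases le_or_gt |x| 1 with hx | hx
  · have h2 := (abs_le.1 (Real.abs_exp_sub_one_sub_id_le hx)).2
    linarith
  rcases lt_abs.1 hx with hx | hx
  · have : Real.exp x ≤ Real.exp (x ^ 2) := Real.exp_le_exp.2 (by nlinarith)
    linarith
  · have : Real.exp x ≤ 1 := Real.exp_le_one_iff.2 (by linarith)
    nlinarith

/-- If the conditional mean of `X` is at most `v` and `|X| ≤ b`, then the conditional moment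
generating function of `X` at `θ ≥ 0` is at most `exp (θ v + θ² b²)`. -/
theorem condExp_exp_mul_le {Ω : Type*} {m m0 : MeasurableSpace Ω} {μ : Measure Ω}
    [IsProbabilityMeasure μ] (hm : m ≤ m0) {X : Ω → ℝ} {θ v b : ℝ} (hθ : 0 ≤ θ) (hv : 0 ≤ v)
    (hX : AEStronglyMeasurable X μ) (hb : ∀ᵐ ω ∂μ, |X ω| ≤ b)
    (hmean : ∀ᵐ ω ∂μ, (μ[X | m]) ω ≤ v) :
    ∀ᵐ ω ∂μ, (μ[fun ω => Real.exp (θ * X ω) | m]) ω ≤ Real.exp (θ * v + θ ^ 2 * b ^ 2) := by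
  have hXint : Integrable X μ := Integrable.of_bound hX b hb
  have hexp : Integrable (fun ω => Real.exp (θ * X ω)) μ := by
    refine Integrable.of_bound
      (Real.continuous_exp.comp_aestronglyMeasurable (hX.const_mul θ)) (Real.exp (θ * b)) ?_
    filter_upwards [hb] with ω hω
    rw [Real.norm_eq_abs, Real.abs_exp, Real.exp_le_exp]
    exact mul_le_mul_of_nonneg_left ((le_abs_self _).trans hω) hθ
  have hle : (fun ω => Real.exp (θ * X ω)) ≤ᵐ[μ]
      (θ • X + fun _ => Real.exp (θ ^ 2 * b ^ 2)) := by
    filter_upwards [hb] with ω hω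
    have h1 := exp_le_add_exp_sq (θ * X ω)
    have h2 : Real.exp ((θ * X ω) ^ 2) ≤ Real.exp (θ ^ 2 * b ^ 2) := by
      rw [Real.exp_le_exp, mul_pow]
      exact mul_le_mul_of_nonneg_left (sq_le_sq' (by linarith [(abs_le.1 hω).1])
        (abs_le.1 hω).2) (sq_nonneg θ)
    simp only [Pi.add_apply, Pi.smul_apply, smul_eq_mul]
    linarith
  have hmono := condExp_mono (m := m) hexp ((hXint.smul θ).add (integrable_const _)) hle
  have hadd := condExp_add (hXint.smul θ)
    (integrable_const (μ := μ) (Real.exp (θ ^ 2 * b ^ 2))) m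
  filter_upwards [hmono, hadd, condExp_smul (μ := μ) θ X m, hmean] with ω h1 h2 h3 h4
  rw [h2, Pi.add_apply, h3, condExp_const hm, Pi.smul_apply, smul_eq_mul] at h1
  have h5 : θ * (μ[X | m]) ω ≤ θ * v := mul_le_mul_of_nonneg_left h4 hθ
  have h6 : 1 ≤ Real.exp (θ ^ 2 * b ^ 2) := Real.one_le_exp (by positivity)
  have h7 := Real.add_one_le_exp (θ * v)
  have h8 : 0 ≤ θ * v := mul_nonneg hθ hv
  rw [Real.exp_add]
  nlinarith

/-- The solution of `Y (n + 1) = a n * Y n + M (n + 1)` started from `0`. -/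
def linearRecursion {Ω : Type*} (a : ℕ → ℝ) (M : ℕ → Ω → ℝ) : ℕ → Ω → ℝ
  | 0 => fun _ => 0
  | n + 1 => fun ω => a n * linearRecursion a M n ω + M (n + 1) ω

section linearRecursion

variable {Ω : Type*} {m0 : MeasurableSpace Ω} {μ : Measure Ω} {F : Filtration ℕ m0}
  {a : ℕ → ℝ} {M : ℕ → Ω → ℝ}

theorem stronglyMeasurable_linearRecursion (hM : ∀ n, StronglyMeasurable[F n] (M n)) (n : ℕ) :
    StronglyMeasurable[F n] (linearRecursion a M n) := by
  induction n with
  | zero => exact stronglyMeasurable_const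
  | succ n ih => exact ((ih.mono (F.mono n.le_succ)).const_mul (a n)).add (hM (n + 1))

theorem abs_linearRecursion_le {b : ℝ} (ha : ∀ n, |a n| ≤ 1)
    (hb : ∀ n, ∀ᵐ ω ∂μ, |M n ω| ≤ b) (n : ℕ) :
    ∀ᵐ ω ∂μ, |linearRecursion a M n ω| ≤ n * b := by
  induction n with
  | zero => simp [linearRecursion]
  | succ n ih =>
    filter_upwards [ih, hb (n + 1)] with ω h1 h2
    have h3 : |a n * linearRecursion a M n ω| ≤ |linearRecursion a M n ω| := by
      rw [abs_mul]
      exact mul_le_of_le_one_left (abs_nonneg _) (ha n)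
    have h4 := abs_add_le (a n * linearRecursion a M n ω) (M (n + 1) ω)
    simp only [linearRecursion]
    push_cast
    linarith

theorem integrable_exp_mul_linearRecursion [IsProbabilityMeasure μ] {b : ℝ}
    (hM : ∀ n, StronglyMeasurable[F n] (M n)) (ha : ∀ n, |a n| ≤ 1)
    (hb : ∀ n, ∀ᵐ ω ∂μ, |M n ω| ≤ b) (θ : ℝ) (n : ℕ) :
    Integrable (fun ω => Real.exp (θ * linearRecursion a M n ω)) μ := by
  refine Integrable.of_bound (Real.continuous_exp.comp_aestronglyMeasurable
    (((stronglyMeasurable_linearRecursion hM n).mono (F.le n)).aestronglyMeasurable.const_mul θ))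
    (Real.exp (|θ| * (n * b))) ?_
  filter_upwards [abs_linearRecursion_le ha hb n] with ω hω
  rw [Real.norm_eq_abs, Real.abs_exp, Real.exp_le_exp]
  refine (le_abs_self _).trans ?_
  rw [abs_mul]
  exact mul_le_mul_of_nonneg_left hω (abs_nonneg _)

/-- If the coefficients lie in `[0, 1 - r]` and the noise has conditional mean at most `r A` and
square bound `r B`, then the moment generating function at `θ ≥ 0` stays below
`exp (A θ + B θ²)`. -/
theorem integral_exp_mul_linearRecursion_le [IsProbabilityMeasure μ] {b r A B : ℝ}
    (hM : ∀ n, StronglyMeasurable[F n] (M n)) (ha0 : ∀ n, 0 ≤ a n) (ha : ∀ n, a n ≤ 1 - r)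
    (hr : 0 ≤ r) (hA : 0 ≤ A) (hB : 0 ≤ B) (hbB : b ^ 2 ≤ r * B)
    (hb : ∀ n, ∀ᵐ ω ∂μ, |M n ω| ≤ b)
    (hmean : ∀ n, ∀ᵐ ω ∂μ, (μ[M (n + 1) | F n]) ω ≤ r * A) (n : ℕ) (θ : ℝ) (hθ : 0 ≤ θ) :
    ∫ ω, Real.exp (θ * linearRecursion a M n ω) ∂μ ≤ Real.exp (A * θ + B * θ ^ 2) := by
  have ha1 : ∀ n, |a n| ≤ 1 := fun n => by
    rw [abs_of_nonneg (ha0 n)]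
    linarith [ha n]
  induction n generalizing θ with
  | zero => simpa [linearRecursion] using by positivity
  | succ n ih =>
    have hYm : StronglyMeasurable[F n]
        (fun ω => Real.exp (θ * a n * linearRecursion a M n ω)) :=
      Real.continuous_exp.comp_stronglyMeasurable
        ((stronglyMeasurable_linearRecursion hM n).const_mul _)
    have hMm : AEStronglyMeasurable (M (n + 1)) μ :=
      ((hM (n + 1)).mono (F.le (n + 1))).aestronglyMeasurable
    have heq : (fun ω => Real.exp (θ * linearRecursion a M (n + 1) ω)) =
        (fun ω => Real.exp (θ * a n * linearRecursion a M n ω)) *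
          fun ω => Real.exp (θ * M (n + 1) ω) := by
      ext ω
      simp only [linearRecursion, Pi.mul_apply, ← Real.exp_add]
      ring_nf
    have hprod := integrable_exp_mul_linearRecursion (μ := μ) hM ha1 hb θ (n + 1)
    rw [heq] at hprod
    have hMexp : Integrable (fun ω => Real.exp (θ * M (n + 1) ω)) μ := by
      refine Integrable.of_bound
        (Real.continuous_exp.comp_aestronglyMeasurable (hMm.const_mul θ)) (Real.exp (θ * b)) ?_
      filter_upwards [hb (n + 1)] with ω hω
      rw [Real.norm_eq_abs, Real.abs_exp, Real.exp_le_exp]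
      exact mul_le_mul_of_nonneg_left ((le_abs_self _).trans hω) hθ
    have hpull := condExp_mul_of_stronglyMeasurable_left hYm hprod hMexp
    have hcond := condExp_exp_mul_le (F.le n) hθ (mul_nonneg hr hA) hMm (hb (n + 1)) (hmean n)
    rw [heq, ← integral_condExp (F.le n)]
    calc _ ≤ ∫ ω, Real.exp (θ * a n * linearRecursion a M n ω) *
          Real.exp (θ * (r * A) + θ ^ 2 * b ^ 2) ∂μ := by
          refine integral_mono_ae integrable_condExp
            ((integrable_exp_mul_linearRecursion hM ha1 hb (θ * a n) n).mul_const _) ?_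
          filter_upwards [hpull, hcond] with ω h1 h2
          rw [h1]
          exact mul_le_mul_of_nonneg_left h2 (Real.exp_pos _).le
      _ = (∫ ω, Real.exp (θ * a n * linearRecursion a M n ω) ∂μ) *
          Real.exp (θ * (r * A) + θ ^ 2 * b ^ 2) := integral_mul_const _ _
      _ ≤ Real.exp (A * (θ * a n) + B * (θ * a n) ^ 2) *
          Real.exp (θ * (r * A) + θ ^ 2 * b ^ 2) :=
          mul_le_mul_of_nonneg_right (ih _ (mul_nonneg hθ (ha0 n))) (Real.exp_pos _).le
      _ ≤ _ := by
          rw [← Real.exp_add, Real.exp_le_exp]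
          have h1 : A * θ * a n ≤ A * θ * (1 - r) :=
            mul_le_mul_of_nonneg_left (ha n) (mul_nonneg hA hθ)
          have h2 : a n ^ 2 ≤ 1 - r := by nlinarith [ha n, ha0 n]
          have h3 : B * θ ^ 2 * a n ^ 2 ≤ B * θ ^ 2 * (1 - r) :=
            mul_le_mul_of_nonneg_left h2 (by positivity)
          have h4 : θ ^ 2 * b ^ 2 ≤ θ ^ 2 * (r * B) :=
            mul_le_mul_of_nonneg_left hbB (sq_nonneg θ)
          nlinarith

end linearRecursion

theorem one_sub_mul_exp_neg_integral_le {φ : ℝ → ℝ} (hφ : MonotoneOn φ (Set.Ici (0 : ℝ)))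
    {ε : ℝ} (hε : 0 ≤ ε) (n : ℕ) :
    (1 - ε * φ (n + 1)) * Real.exp (-(ε * ∫ s in (0 : ℝ)..(n : ℝ), φ s)) ≤
      Real.exp (-(ε * ∫ s in (0 : ℝ)..((n : ℝ) + 1), φ s)) := by
  have hn : (0 : ℝ) ≤ n := n.cast_nonneg
  have hint : ∀ x y : ℝ, 0 ≤ x → 0 ≤ y → IntervalIntegrable φ volume x y := fun x y hx hy =>
    (hφ.mono fun s hs => (le_inf hx hy).trans hs.1).intervalIntegrable
  have hle : ∫ s in (n : ℝ)..((n : ℝ) + 1), φ s ≤ φ (n + 1) := by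
    calc _ ≤ ∫ _ in (n : ℝ)..((n : ℝ) + 1), φ (n + 1) :=
          intervalIntegral.integral_mono_on (by linarith) (hint _ _ hn (by linarith))
            intervalIntegrable_const fun s hs =>
              hφ (hn.trans hs.1) (Set.mem_Ici.2 (by linarith)) hs.2
      _ = _ := by simp
  rw [← intervalIntegral.integral_add_adjacent_intervals (hint 0 n le_rfl hn)
    (hint n (n + 1) hn (by linarith))]
  have h1 := Real.add_one_le_exp (-(ε * ∫ s in (n : ℝ)..((n : ℝ) + 1), φ s))
  have h2 := mul_le_mul_of_nonneg_left hle hε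
  rw [mul_add, neg_add, Real.exp_add, mul_comm (Real.exp _)]
  exact mul_le_mul_of_nonneg_right (by linarith) (Real.exp_pos _).le

/-- Lemma 3.1: a general estimate for stochastic difference equations.
Let `(z(t))` be `[0,1]`-valued and adapted to a filtration `(F_t)`, let `ε ∈ (0,1)` and let
`φ : ℝ⁺ → (0,1]` be non-decreasing.  Suppose `M(t)` is `F_t`-measurable with
`z(t+1) − z(t) ≤ −ε φ(t+1) z(t) + M(t+1)`, `E[M(t+1) | F_t] ≤ D ε √ε` and `|M(t)| ≤ D ε`.
Then for each `t` and `λ > 0`,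
`Pr(z(t) ≥ λ √ε + e^{−ε ∫₀ᵗ φ} z(0)) ≤ C_{D,φ} e^{−c_{D,φ} λ²}`,
with constants depending only on `D` and `φ`. -/
theorem stochastic_difference_equation_estimate
    (D : ℝ) (φ : ℝ → ℝ)
    (hφ_pos : ∀ s : ℝ, 0 ≤ s → 0 < φ s) (hφ_le : ∀ s : ℝ, 0 ≤ s → φ s ≤ 1)
    (hφ_mono : MonotoneOn φ (Set.Ici (0 : ℝ))) :
    ∃ c C : ℝ, 0 < c ∧ 0 < C ∧
      ∀ (Ω : Type) (m0 : MeasurableSpace Ω) (μ : Measure Ω), IsProbabilityMeasure μ →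
      ∀ (F : Filtration ℕ m0) (z M : ℕ → Ω → ℝ) (ε : ℝ), 0 < ε → ε < 1 →
        Adapted F z →
        (∀ t : ℕ, StronglyMeasurable[F t] (M t)) →
        (∀ t : ℕ, ∀ᵐ ω ∂μ, z t ω ∈ Set.Icc (0 : ℝ) 1) →
        (∀ t : ℕ, ∀ᵐ ω ∂μ,
          z (t + 1) ω - z t ω ≤ -(ε * φ (t + 1) * z t ω) + M (t + 1) ω) →
        (∀ t : ℕ, ∀ᵐ ω ∂μ, (μ[M (t + 1) | F t]) ω ≤ D * ε * Real.sqrt ε) →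
        (∀ t : ℕ, ∀ᵐ ω ∂μ, |M t ω| ≤ D * ε) →
        ∀ (t : ℕ) (lam : ℝ), 0 < lam →
          (μ {ω | lam * Real.sqrt ε
              + Real.exp (-(ε * ∫ s in (0 : ℝ)..(t : ℝ), φ s)) * z 0 ω ≤ z t ω}).toReal
            ≤ C * Real.exp (-(c * lam ^ 2)) := by
  have hp : 0 < φ 0 := hφ_pos 0 le_rfl
  have hK : 0 < D ^ 2 + 1 := by positivity
  refine ⟨φ 0 / (8 * (D ^ 2 + 1)), Real.exp (D ^ 2 / (2 * (D ^ 2 + 1) * φ 0)), by positivity,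
    Real.exp_pos _, ?_⟩
  intro Ω m0 μ _ F z M ε hε hε1 _ hM hz hrec hmean hb t lam hlam
  have hD : 0 ≤ D := by
    obtain ⟨ω, hω⟩ := (hb 0).exists
    exact nonneg_of_mul_nonneg_left ((abs_nonneg _).trans hω) hε
  have hsq : Real.sqrt ε ^ 2 = ε := Real.sq_sqrt hε.le
  have hs : 0 < Real.sqrt ε := Real.sqrt_pos.2 hε
  set a : ℕ → ℝ := fun n => 1 - ε * φ (n + 1) with ha_def
  have ha0 : ∀ n, 0 ≤ a n := fun n => by
    have := hφ_le (n + 1) (by positivity)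
    have := hφ_pos (n + 1) (by positivity)
    simp only [ha_def]
    nlinarith
  have ha : ∀ n, a n ≤ 1 - ε * φ 0 := fun n => by
    have h1 : (0 : ℝ) ≤ n + 1 := by positivity
    have := mul_le_mul_of_nonneg_left (hφ_mono (Set.mem_Ici.2 le_rfl) h1 h1) hε.le
    simp only [ha_def]
    linarith
  have ha1 : ∀ n, |a n| ≤ 1 := fun n => by
    rw [abs_of_nonneg (ha0 n)]
    linarith [ha n, mul_pos hε hp]
  have hcomp : ∀ n : ℕ, ∀ᵐ ω ∂μ, z n ω ≤
      Real.exp (-(ε * ∫ s in (0 : ℝ)..(n : ℝ), φ s)) * z 0 ω + linearRecursion a M n ω := by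
    intro n
    induction n with
    | zero => simp [linearRecursion]
    | succ n ih =>
      filter_upwards [ih, hz 0, hrec n] with ω h1 h2 h3
      have h4 := mul_le_mul_of_nonneg_right
        (one_sub_mul_exp_neg_integral_le hφ_mono hε.le n) h2.1
      have h5 := mul_le_mul_of_nonneg_left h1 (ha0 n)
      simp only [linearRecursion, Nat.cast_add, Nat.cast_one]
      simp only [ha_def] at h5 ⊢
      linarith
  set θ : ℝ := lam * φ 0 / (2 * (D ^ 2 + 1)) / Real.sqrt ε with hθ_def
  have hθ : 0 ≤ θ := by positivity
  have hmgf := integral_exp_mul_linearRecursion_le (μ := μ) (b := D * ε) (r := ε * φ 0)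
    (A := D * Real.sqrt ε / φ 0) (B := (D ^ 2 + 1) * ε / φ 0) hM ha0 ha (by positivity)
    (by positivity) (by positivity)
    (by
      have : ε * φ 0 * ((D ^ 2 + 1) * ε / φ 0) = (D ^ 2 + 1) * ε ^ 2 := by field_simp
      rw [this]
      nlinarith [sq_nonneg ε]) hb
    (fun n => by
      filter_upwards [hmean n] with ω hω
      refine hω.trans_eq ?_
      field_simp) t θ hθ
  calc _ ≤ μ.real {ω | lam * Real.sqrt ε ≤ linearRecursion a M t ω} := by
        refine ENNReal.toReal_mono (measure_ne_top _ _) (measure_mono_ae ?_)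
        filter_upwards [hcomp t] with ω h1 h2
        have h3 : _ ≤ z t ω := h2
        change _ ≤ _
        linarith
    _ ≤ Real.exp (-θ * (lam * Real.sqrt ε)) * ProbabilityTheory.mgf _ μ θ :=
        ProbabilityTheory.measure_ge_le_exp_mul_mgf _ hθ
          (integrable_exp_mul_linearRecursion hM ha1 hb θ t)
    _ ≤ Real.exp (-θ * (lam * Real.sqrt ε)) * _ :=
        mul_le_mul_of_nonneg_left hmgf (Real.exp_pos _).le
    _ ≤ _ := by
        rw [← Real.exp_add, ← Real.exp_add, Real.exp_le_exp]
        have hθs : θ * Real.sqrt ε = lam * φ 0 / (2 * (D ^ 2 + 1)) := by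
          rw [hθ_def]
          field_simp
        have e1 : -θ * (lam * Real.sqrt ε) + (D * Real.sqrt ε / φ 0 * θ +
            (D ^ 2 + 1) * ε / φ 0 * θ ^ 2) = -lam * (θ * Real.sqrt ε) +
            (D / φ 0 * (θ * Real.sqrt ε) + (D ^ 2 + 1) / φ 0 * (θ * Real.sqrt ε) ^ 2) := by
          rw [mul_pow, hsq]
          ring
        rw [e1, hθs, ← sub_nonneg]
        have e2 : D ^ 2 / (2 * (D ^ 2 + 1) * φ 0) + -(φ 0 / (8 * (D ^ 2 + 1)) * lam ^ 2) -
            (-lam * (lam * φ 0 / (2 * (D ^ 2 + 1))) +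
            (D / φ 0 * (lam * φ 0 / (2 * (D ^ 2 + 1))) +
              (D ^ 2 + 1) / φ 0 * (lam * φ 0 / (2 * (D ^ 2 + 1))) ^ 2)) =
            (2 * D - lam * φ 0) ^ 2 / (8 * (D ^ 2 + 1) * φ 0) := by
          field_simp
          ring
        rw [e2]
        positivity
end
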